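/- arXiv:1411.6184 — 3 statements merged into one kernel-verified Lean document; each statement's English description precedes it below -/
import Mathlib

section
/- For every n ≥ 1, Σ_{σ∈S_n} t^{exc σ} q^{inv σ - exc σ} = Σ_{0 ≤ k ≤ (n-1)/2} γ_{n,k}(q) t^k (1+t)^{n-1-2k}, where γ_{n,k}(q) = Σ_{σ∈DD_{n,k}} q^{2·res σ + les σ}. -/
open Finset

/-- The word `σ(1)…σ(n)0…` (1-based values, 0-based positions), with value 0 beyond position n. -/
def wrd {n : ℕ} (σ : Equiv.Perm (Fin n)) (i : ℕ) : ℕ :=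
  if h : i < n then ((σ ⟨i, h⟩ : Fin n) : ℕ) + 1 else 0

/-- Number of descents of `σ`. -/
def desN {n : ℕ} (σ : Equiv.Perm (Fin n)) : ℕ :=
  ((Finset.range (n - 1)).filter fun i => wrd σ (i + 1) < wrd σ i).card

/-- Number of double descents of the word `σ0`. -/
def ddN {n : ℕ} (σ : Equiv.Perm (Fin n)) : ℕ :=
  ((Finset.Ico 1 n).filter fun i => wrd σ (i + 1) < wrd σ i ∧ wrd σ i < wrd σ (i - 1)).card

/-- Permutations with `k` descents and no double descent in `σ0`. -/
def DDset (n k : ℕ) : Finset (Equiv.Perm (Fin n)) :=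
  Finset.univ.filter fun σ => desN σ = k ∧ ddN σ = 0

/-- Number of excedances. -/
def excN {n : ℕ} (σ : Equiv.Perm (Fin n)) : ℕ :=
  (Finset.univ.filter fun i : Fin n => i < σ i).card

/-- Number of weak excedances. -/
def wexN {n : ℕ} (σ : Equiv.Perm (Fin n)) : ℕ :=
  (Finset.univ.filter fun i : Fin n => i ≤ σ i).card

/-- Number of fixed points. -/
def fixN {n : ℕ} (σ : Equiv.Perm (Fin n)) : ℕ :=
  (Finset.univ.filter fun i : Fin n => σ i = i).card

/-- Number of drops. -/
def dropN {n : ℕ} (σ : Equiv.Perm (Fin n)) : ℕ :=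
  (Finset.univ.filter fun i : Fin n => σ i < i).card

/-- Number of inversions. -/
def invN {n : ℕ} (σ : Equiv.Perm (Fin n)) : ℕ :=
  ((Finset.univ : Finset (Fin n × Fin n)).filter fun p => p.1 < p.2 ∧ σ p.2 < σ p.1).card

/-- Number of cyclic double ascents (double excedances): `i < σ(i) < σ(σ(i))`. -/
def cdaN {n : ℕ} (σ : Equiv.Perm (Fin n)) : ℕ :=
  (Finset.univ.filter fun i : Fin n => i < σ i ∧ σ i < σ (σ i)).card

/-- `les σ` : pairs (i,j), 2 ≤ i < j ≤ n (1-based) with σ(i-1) > σ(j) > σ(i). -/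
def lesN {n : ℕ} (σ : Equiv.Perm (Fin n)) : ℕ :=
  (((Finset.Ico 1 n) ×ˢ (Finset.Ico 1 n)).filter fun p =>
      p.1 < p.2 ∧ wrd σ p.1 < wrd σ p.2 ∧ wrd σ p.2 < wrd σ (p.1 - 1)).card

/-- `res σ` : pairs (i,j), 1 ≤ i < j ≤ n-1 (1-based) with σ(j+1) > σ(i) > σ(j). -/
def resN {n : ℕ} (σ : Equiv.Perm (Fin n)) : ℕ :=
  (((Finset.range (n - 1)) ×ˢ (Finset.range (n - 1))).filter fun p =>
      p.1 < p.2 ∧ wrd σ p.2 < wrd σ p.1 ∧ wrd σ p.1 < wrd σ (p.2 + 1)).card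

/-- Crossings. -/
def crosN {n : ℕ} (σ : Equiv.Perm (Fin n)) : ℕ :=
  ((Finset.univ : Finset (Fin n × Fin n)).filter fun p =>
      (p.1 < p.2 ∧ p.2 ≤ σ p.1 ∧ σ p.1 < σ p.2) ∨
      (p.2 < p.1 ∧ σ p.1 < p.2 ∧ σ p.2 < σ p.1)).card

/-- Nestings. -/
def nestN {n : ℕ} (σ : Equiv.Perm (Fin n)) : ℕ :=
  ((Finset.univ : Finset (Fin n × Fin n)).filter fun p =>
      (p.1 < p.2 ∧ p.2 ≤ σ p.2 ∧ σ p.2 < σ p.1) ∨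
      (p.2 < p.1 ∧ σ p.2 < p.2 ∧ σ p.1 < σ p.2)).card

/-- Derangements of `[n]`. -/
def Der (n : ℕ) : Finset (Equiv.Perm (Fin n)) :=
  Finset.univ.filter fun σ => ∀ i, σ i ≠ i

/-- Derangements with `k` excedances and no cyclic double ascent. -/
def DEset (n k : ℕ) : Finset (Equiv.Perm (Fin n)) :=
  (Der n).filter fun σ => excN σ = k ∧ cdaN σ = 0

/-- `γ_{n,i,j}`: permutations with `i` fixed points, `j` excedances, no double excedance. -/
def gam (n i j : ℕ) : ℕ :=
  (Finset.univ.filter fun τ : Equiv.Perm (Fin n) =>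
      fixN τ = i ∧ excN τ = j ∧ cdaN τ = 0).card

/-- `γ_{n,k}^{(2)}`: permutations with `k` weak excedances and no double excedance. -/
def gam2 (n k : ℕ) : ℕ :=
  (Finset.univ.filter fun τ : Equiv.Perm (Fin n) => wexN τ = k ∧ cdaN τ = 0).card

/-- Derangements in the wreath product `Z_r ≀ S_n` (no `i` with `π i = i` and color 0). -/
def ColDer (r n : ℕ) : Finset (Equiv.Perm (Fin n) × (Fin n → Fin r)) :=
  Finset.univ.filter fun σ => ∀ i, σ.1 i = i → (σ.2 i : ℕ) ≠ 0

/-- Flag excedance. -/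
def fexc {r n : ℕ} (σ : Equiv.Perm (Fin n) × (Fin n → Fin r)) : ℕ :=
  r * excN σ.1 + ∑ i, (σ.2 i : ℕ)

/-- Excedance with respect to the friends order. -/
def cexc {r n : ℕ} (σ : Equiv.Perm (Fin n) × (Fin n → Fin r)) : ℕ :=
  excN σ.1 + (Finset.univ.filter fun i => i ≤ σ.1 i ∧ (σ.2 i : ℕ) ≠ 0).card

/-- `D_n^{(r)}(t)` as a polynomial in `ℤ[t]`. -/
noncomputable def DPoly (r n : ℕ) : Polynomial ℤ :=
  ∑ σ ∈ ColDer r n, Polynomial.X ^ fexc σ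

/-- `d_n^{(r)}(t)` as a polynomial in `ℤ[t]`. -/
noncomputable def dPolyC (r n : ℕ) : Polynomial ℤ :=
  ∑ σ ∈ ColDer r n, Polynomial.X ^ cexc σ

/-- The type-A derangement polynomial `d_n(t)`. -/
noncomputable def derPoly (n : ℕ) : Polynomial ℤ :=
  ∑ σ ∈ Der n, Polynomial.X ^ excN σ

/-- Drop-colored permutations (colors 1,2 allowed only on drops) without double excedance. -/
def DCset (n : ℕ) : Finset (Equiv.Perm (Fin n) × (Fin n → Fin 3)) :=
  Finset.univ.filter fun σ => cdaN σ.1 = 0 ∧ ∀ i, (σ.2 i : ℕ) ≠ 0 → σ.1 i < i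

/-- Number of colored drops. -/
def cdropN {n : ℕ} (σ : Equiv.Perm (Fin n) × (Fin n → Fin 3)) : ℕ :=
  (Finset.univ.filter fun i => (σ.2 i : ℕ) ≠ 0).card

/-- `ĝ_{n,k}`. -/
def ghat (n k : ℕ) : ℕ :=
  ((DCset n).filter fun σ => wexN σ.1 + cdropN σ = k).card

/-- Insertion of the entry `r ↦ c` into a permutation, shifting the other rows and columns. -/
def permInsert {n : ℕ} (r c : Fin (n + 1)) (τ : Equiv.Perm (Fin n)) : Equiv.Perm (Fin (n + 1)) :=
  (finSuccEquiv' r).trans ((Equiv.optionCongr τ).trans (finSuccEquiv' c).symm)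

lemma permInsert_self {n : ℕ} (r c : Fin (n + 1)) (τ : Equiv.Perm (Fin n)) :
    permInsert r c τ r = c := by
  simp [permInsert]

lemma permInsert_succAbove {n : ℕ} (r c : Fin (n + 1)) (τ : Equiv.Perm (Fin n)) (i : Fin n) :
    permInsert r c τ (r.succAbove i) = c.succAbove (τ i) := by
  simp [permInsert]

lemma permInsert_injective {n : ℕ} {r c : Fin (n + 1)} {τ τ' : Equiv.Perm (Fin n)}
    (h : permInsert r c τ = permInsert r c τ') : τ = τ' := by
  ext i
  have := congrArg (fun σ => σ (r.succAbove i)) h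
  simp only [permInsert_succAbove] at this
  exact congrArg _ (Fin.succAbove_right_injective this)

lemma sum_perm_row {n : ℕ} (r : Fin (n + 1)) (F : Equiv.Perm (Fin (n + 1)) → ℤ) :
    ∑ σ, F σ = ∑ c, ∑ τ, F (permInsert r c τ) := by
  rw [← Fintype.sum_prod_type']
  refine (Fintype.sum_bijective (fun x : Fin (n + 1) × Equiv.Perm (Fin n) =>
    permInsert r x.1 x.2) ?_ _ _ fun _ => rfl).symm
  rw [Fintype.bijective_iff_injective_and_card]
  refine ⟨?_, by simp [Fintype.card_perm, Nat.factorial_succ]⟩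
  rintro ⟨c, τ⟩ ⟨c', τ'⟩ h
  have hc : c = c' := by
    have := congrArg (fun σ => σ r) h
    simpa only [permInsert_self] using this
  subst hc
  exact Prod.ext rfl (permInsert_injective h)

lemma sum_perm_col {n : ℕ} (c : Fin (n + 1)) (F : Equiv.Perm (Fin (n + 1)) → ℤ) :
    ∑ σ, F σ = ∑ r, ∑ τ, F (permInsert r c τ) := by
  rw [← Fintype.sum_prod_type']
  refine (Fintype.sum_bijective (fun x : Fin (n + 1) × Equiv.Perm (Fin n) =>
    permInsert x.1 c x.2) ?_ _ _ fun _ => rfl).symm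
  rw [Fintype.bijective_iff_injective_and_card]
  refine ⟨?_, by simp [Fintype.card_perm, Nat.factorial_succ]⟩
  rintro ⟨r, τ⟩ ⟨r', τ'⟩ h
  have hr : r = r' := by
    have h1 : permInsert r c τ r = permInsert r' c τ' r' := by simp only [permInsert_self]
    have h2 : permInsert r c τ = permInsert r' c τ' := h
    rw [h2] at h1
    exact (permInsert r' c τ').injective h1
  subst hr
  exact Prod.ext rfl (permInsert_injective h)

/-- The first `a` rows avoid the first `b` columns. -/
def AvoidsCorner {n : ℕ} (a b : ℕ) (σ : Equiv.Perm (Fin n)) : Prop :=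
  ∀ i : Fin n, (i : ℕ) < a → b ≤ (σ i : ℕ)

lemma val_succAbove {n : ℕ} (r : Fin (n + 1)) (i : Fin n) :
    (r.succAbove i : ℕ) = if (i : ℕ) < r then (i : ℕ) else i + 1 := by
  simp only [Fin.succAbove, Fin.lt_def, Fin.val_castSucc]
  split_ifs <;> simp

lemma card_fin_lt {n k : ℕ} (hk : k ≤ n) :
    (univ.filter fun i : Fin n => (i : ℕ) < k).card = k := by
  rw [Fin.card_filter_val_lt, min_eq_right hk]

lemma excN_permInsert {n a b : ℕ} {r c : Fin (n + 1)} {τ : Equiv.Perm (Fin n)}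
    (h : AvoidsCorner a b τ) (hab : a ≤ b) (hba : b ≤ a + 1) (hr : (r : ℕ) ≤ a)
    (hc : (c : ℕ) ≤ b) :
    excN (permInsert r c τ) = excN τ + if r < c then 1 else 0 := by
  simp only [excN, card_filter]
  rw [Fin.sum_univ_succAbove _ r, add_comm]
  simp only [permInsert_self, permInsert_succAbove]
  congr 1
  refine sum_congr rfl fun i _ => ?_
  have := h i
  simp only [Fin.lt_def, val_succAbove]
  refine if_congr ?_ rfl rfl
  split_ifs <;> omega

lemma invN_permInsert {n a b : ℕ} {r c : Fin (n + 1)} {τ : Equiv.Perm (Fin n)}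
    (h : AvoidsCorner a b τ) (hr : (r : ℕ) ≤ a) (hc : (c : ℕ) ≤ b) :
    invN (permInsert r c τ) = invN τ + r + c := by
  have e1 : (∑ j : Fin n, if r < r.succAbove j ∧ c.succAbove (τ j) < c then 1 else 0) = (c : ℕ) := by
    rw [← card_filter]
    trans (univ.filter fun j : Fin n => (τ j : ℕ) < c).card
    · congr 1
      refine filter_congr fun j _ => ?_
      have := h j
      simp only [Fin.lt_def, val_succAbove]
      split_ifs <;> omega
    · refine Eq.trans ?_ (card_fin_lt (n := n) (k := c) (by omega))
      refine card_bij (fun j _ => τ j) (by simp) (by simp) fun j hj => ⟨τ.symm j, ?_, by simp⟩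
      simpa using hj
  have e2 : (∑ j : Fin n, if r.succAbove j < r ∧ c < c.succAbove (τ j) then 1 else 0) = (r : ℕ) := by
    rw [← card_filter, ← card_fin_lt (n := n) (k := r) (by omega)]
    congr 1
    refine filter_congr fun j _ => ?_
    have := h j
    simp only [Fin.lt_def, val_succAbove]
    split_ifs <;> omega
  simp only [invN, card_filter, Fintype.sum_prod_type]
  rw [Fin.sum_univ_succAbove _ r]
  simp_rw [Fin.sum_univ_succAbove _ r]
  simp only [permInsert_self, permInsert_succAbove, Fin.succAbove_lt_succAbove_iff, lt_irrefl,
    false_and, if_false, zero_add, sum_add_distrib, e1, e2]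
  ring

lemma excN_le_invN {n : ℕ} (σ : Equiv.Perm (Fin n)) : excN σ ≤ invN σ := by
  have key : ∀ i : Fin n, i < σ i → ∃ j, i < j ∧ σ j ≤ i := by
    intro i hi
    by_contra! hcon
    have hmap : (Ioi i).image σ ⊆ Ioi i := by
      intro x hx
      obtain ⟨j, hj, rfl⟩ := mem_image.1 hx
      exact mem_Ioi.2 (hcon j (mem_Ioi.1 hj))
    have heq := eq_of_subset_of_card_le hmap (by rw [card_image_of_injective _ σ.injective])
    have : σ i ∈ (Ioi i).image σ := by
      rw [heq]; exact mem_Ioi.2 hi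
    obtain ⟨j, hj, hji⟩ := mem_image.1 this
    exact absurd (σ.injective hji) (mem_Ioi.1 hj).ne'
  choose! f hf using key
  refine card_le_card_of_injOn (fun i => (i, f i)) ?_ ?_
  · intro i hi
    have hi' : i < σ i := by simpa using hi
    have := hf i hi'
    simpa using ⟨this.1, this.2.trans_lt hi'⟩
  · intro i _ j _ hij
    exact (Prod.ext_iff.1 hij).1

open Classical in
/-- The generating function of `(exc, inv - exc)` over permutations whose first `a` rows avoid the
first `b` columns. -/
noncomputable def cornerSum (t q : ℤ) (n a b : ℕ) : ℤ :=
  ∑ σ : Equiv.Perm (Fin n),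
    if AvoidsCorner a b σ then t ^ excN σ * q ^ (invN σ - excN σ) else 0

/-- The weight `q ^ k + q ^ (k + 1) + ⋯ + q ^ (2 * k)`. -/
def stepWeight (q : ℤ) (k : ℕ) : ℤ := ∑ i ∈ range (k + 1), q ^ (k + i)

lemma avoidsCorner_permInsert_row {n k : ℕ} {r c : Fin (n + 1)} {τ : Equiv.Perm (Fin n)}
    (hr : (r : ℕ) = k) (hc : (c : ℕ) ≤ k) :
    AvoidsCorner k (k + 1) (permInsert r c τ) ↔ AvoidsCorner k k τ := by
  constructor
  · intro h i hi
    have := h (r.succAbove i)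
    rw [permInsert_succAbove, val_succAbove, val_succAbove] at this
    split_ifs at this <;> omega
  · intro h i hi
    obtain rfl | ⟨j, rfl⟩ := Fin.eq_self_or_eq_succAbove r i
    · omega
    · have := h j
      rw [permInsert_succAbove, val_succAbove]
      rw [val_succAbove] at hi
      split_ifs at hi ⊢ <;> omega

lemma avoidsCorner_permInsert_col {n k : ℕ} {r c : Fin (n + 1)} {τ : Equiv.Perm (Fin n)}
    (hr : (r : ℕ) ≤ k) (hc : (c : ℕ) = k + 1) :
    AvoidsCorner (k + 1) (k + 1) (permInsert r c τ) ↔ AvoidsCorner k (k + 1) τ := by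
  constructor
  · intro h i hi
    have := h (r.succAbove i)
    rw [permInsert_succAbove, val_succAbove, val_succAbove] at this
    split_ifs at this <;> omega
  · intro h i hi
    obtain rfl | ⟨j, rfl⟩ := Fin.eq_self_or_eq_succAbove r i
    · rw [permInsert_self]; omega
    · have := h j
      rw [permInsert_succAbove, val_succAbove]
      rw [val_succAbove] at hi
      split_ifs at hi ⊢ <;> omega

lemma sum_fin_le {n k : ℕ} (hk : k ≤ n) (q : ℤ) :
    (∑ c : Fin (n + 1), if (c : ℕ) ≤ k then q ^ (k + c) else 0) = stepWeight q k := by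
  rw [Fin.sum_univ_eq_sum_range (fun c => if c ≤ k then q ^ (k + c) else 0), ← sum_filter,
    stepWeight]
  refine sum_congr ?_ fun _ _ => rfl
  ext; simp; omega

lemma cornerSum_row (t q : ℤ) {n k : ℕ} (hk : k ≤ n) :
    cornerSum t q (n + 1) k (k + 1) =
      cornerSum t q (n + 1) (k + 1) (k + 1) + stepWeight q k * cornerSum t q n k k := by
  classical
  let r : Fin (n + 1) := ⟨k, by omega⟩
  have hsplit : cornerSum t q (n + 1) k (k + 1) = cornerSum t q (n + 1) (k + 1) (k + 1) +
      ∑ σ : Equiv.Perm (Fin (n + 1)), if AvoidsCorner k (k + 1) σ ∧ (σ r : ℕ) ≤ k then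
        t ^ excN σ * q ^ (invN σ - excN σ) else 0 := by
    rw [cornerSum, cornerSum, ← sum_add_distrib]
    refine sum_congr rfl fun σ _ => ?_
    have : AvoidsCorner (k + 1) (k + 1) σ ↔ AvoidsCorner k (k + 1) σ ∧ ¬ (σ r : ℕ) ≤ k := by
      constructor
      · intro h
        exact ⟨fun i hi => h i (by omega), by have := h r (Nat.lt_succ_self k); omega⟩
      · rintro ⟨h, h'⟩ i hi
        rcases Nat.lt_succ_iff_lt_or_eq.1 hi with hi | hi
        · exact h i hi
        · have : i = r := Fin.ext hi
          subst this; omega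
    by_cases h1 : AvoidsCorner k (k + 1) σ <;> by_cases h2 : (σ r : ℕ) ≤ k <;> simp [this, h1, h2]
  rw [hsplit, sum_perm_row r, ← sum_fin_le hk, sum_mul]
  congr 1
  refine sum_congr rfl fun c _ => ?_
  rw [cornerSum, mul_sum]
  refine sum_congr rfl fun τ _ => ?_
  by_cases hc : (c : ℕ) ≤ k
  · by_cases hτ : AvoidsCorner k k τ
    · have e := excN_permInsert (r := r) (c := c) hτ le_rfl (by omega) le_rfl hc
      have i := invN_permInsert (r := r) (c := c) hτ le_rfl hc
      have hrc : ¬ r < c := by simp only [Fin.lt_def, r]; omega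
      rw [if_neg hrc] at e
      rw [if_pos ⟨(avoidsCorner_permInsert_row (r := r) (k := k) rfl hc).2 hτ, by rwa [permInsert_self]⟩,
        if_pos hc, if_pos hτ, e, i]
      have hle := excN_le_invN τ
      have : invN τ + r + c - (excN τ + 0) = (k + c) + (invN τ - excN τ) := by
        simp only [r]; omega
      rw [this, pow_add]
      ring
    · rw [if_neg fun h => hτ ((avoidsCorner_permInsert_row (r := r) (k := k) rfl hc).1 h.1), if_neg hτ, mul_zero]
  · rw [if_neg fun h => hc (by simpa only [permInsert_self] using h.2), if_neg hc, zero_mul]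

lemma cornerSum_col (t q : ℤ) {n k : ℕ} (hk : k < n) :
    cornerSum t q (n + 1) (k + 1) (k + 1) =
      cornerSum t q (n + 1) (k + 1) (k + 2) +
        t * stepWeight q k * cornerSum t q n k (k + 1) := by
  classical
  let c : Fin (n + 1) := ⟨k + 1, by omega⟩
  have hsplit : cornerSum t q (n + 1) (k + 1) (k + 1) = cornerSum t q (n + 1) (k + 1) (k + 2) +
      ∑ σ : Equiv.Perm (Fin (n + 1)), if AvoidsCorner (k + 1) (k + 1) σ ∧ (σ.symm c : ℕ) ≤ k then
        t ^ excN σ * q ^ (invN σ - excN σ) else 0 := by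
    rw [cornerSum, cornerSum, ← sum_add_distrib]
    refine sum_congr rfl fun σ _ => ?_
    have : AvoidsCorner (k + 1) (k + 2) σ ↔
        AvoidsCorner (k + 1) (k + 1) σ ∧ ¬ (σ.symm c : ℕ) ≤ k := by
      constructor
      · intro h
        refine ⟨fun i hi => by have := h i hi; omega, fun h' => ?_⟩
        have := h (σ.symm c) (by omega)
        simp [c] at this
      · rintro ⟨h, h'⟩ i hi
        have h1 := h i hi
        have h2 : (σ i : ℕ) ≠ k + 1 := by
          intro h3
          have : σ i = c := Fin.ext h3
          rw [← this, σ.symm_apply_apply] at h'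
          omega
        omega
    by_cases h1 : AvoidsCorner (k + 1) (k + 1) σ <;> by_cases h2 : (σ.symm c : ℕ) ≤ k <;>
      simp [this, h1, h2]
  rw [hsplit, sum_perm_col c, ← sum_fin_le hk.le, mul_sum, sum_mul]
  congr 1
  refine sum_congr rfl fun r _ => ?_
  rw [cornerSum, mul_sum]
  refine sum_congr rfl fun τ _ => ?_
  have hsymm : (permInsert r c τ).symm c = r := by
    rw [Equiv.symm_apply_eq, permInsert_self]
  by_cases hr : (r : ℕ) ≤ k
  · by_cases hτ : AvoidsCorner k (k + 1) τ
    · have e := excN_permInsert (r := r) (c := c) hτ (by omega) le_rfl hr le_rfl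
      have i := invN_permInsert (r := r) (c := c) hτ hr le_rfl
      have hrc : r < c := by simp only [Fin.lt_def, c]; omega
      rw [if_pos hrc] at e
      rw [if_pos ⟨(avoidsCorner_permInsert_col hr rfl).2 hτ, by rwa [hsymm]⟩,
        if_pos hr, if_pos hτ, e, i]
      have hle := excN_le_invN τ
      have : invN τ + r + c - (excN τ + 1) = (k + r) + (invN τ - excN τ) := by
        simp only [c]; omega
      rw [this, pow_add, pow_succ]
      ring
    · rw [if_neg fun h => hτ ((avoidsCorner_permInsert_col hr rfl).1 h.1), if_neg hτ, mul_zero]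
  · rw [if_neg fun h => hr (by simpa only [hsymm] using h.2), if_neg hr]
    ring

lemma cornerSum_zero_zero (t q : ℤ) (n : ℕ) :
    cornerSum t q n 0 0 = ∑ σ : Equiv.Perm (Fin n), t ^ excN σ * q ^ (invN σ - excN σ) := by
  simp [cornerSum, AvoidsCorner]

lemma cornerSum_zero_left (t q : ℤ) (n b : ℕ) : cornerSum t q n 0 b = cornerSum t q n 0 0 := by
  simp [cornerSum, AvoidsCorner]

lemma cornerSum_full (t q : ℤ) (k : ℕ) : cornerSum t q (k + 2) (k + 1) (k + 2) = 0 := by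
  refine sum_eq_zero fun σ _ => if_neg fun h => ?_
  have := h 0 (by simp)
  omega

lemma cornerSum_one (t q : ℤ) : cornerSum t q 1 0 1 = 1 := by
  rw [cornerSum_zero_left, cornerSum_zero_zero, Fintype.sum_unique, Equiv.Perm.default_eq]
  have h : invN (1 : Equiv.Perm (Fin 1)) = 0 := by decide
  have h' : excN (1 : Equiv.Perm (Fin 1)) = 0 := by decide
  simp [h, h']

/-- Weighted Motzkin-type paths with `m` steps from height `s` to height `0`. -/
def pathSum (t q : ℤ) : ℕ → ℕ → ℤ
  | 0, s => if s = 0 then 1 else 0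
  | _ + 1, 0 => 0
  | m + 1, k + 1 => stepWeight q k *
      (t * pathSum t q m (k + 2) + (1 + t) * pathSum t q m (k + 1) + pathSum t q m k)

lemma cornerSum_eq_pathSum (t q : ℤ) (m : ℕ) : ∀ k,
    cornerSum t q (m + 1 + k) k (k + 1) =
      (∏ j ∈ range k, t * stepWeight q j) * pathSum t q (m + 1) (k + 1) := by
  induction m with
  | zero =>
    rintro (_ | k)
    · simp [cornerSum_one, pathSum, stepWeight]
    · rw [show 0 + 1 + (k + 1) = k + 2 by ring, cornerSum_full]
      simp [pathSum]
  | succ m ih =>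
    intro k
    have i1 := ih (k + 1)
    have i0 := ih k
    have hp : pathSum t q (m + 1 + 1) (k + 1) = stepWeight q k * (t * pathSum t q (m + 1) (k + 2) +
      (1 + t) * pathSum t q (m + 1) (k + 1) + pathSum t q (m + 1) k) := rfl
    rw [show m + 1 + (k + 1) = (m + 1 + k) + 1 by ring, prod_range_succ] at i1
    rw [show m + 1 + 1 + k = (m + 1 + k) + 1 by ring, cornerSum_row t q (by omega),
      cornerSum_col t q (by omega), i0, i1, hp]
    rcases k with _ | k
    · rw [← cornerSum_zero_left t q _ 1, i0, show pathSum t q (m + 1) 0 = 0 from rfl]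
      ring
    · rw [show m + 1 + (k + 1) = (m + 1 + k) + 1 by ring] at i0 ⊢
      rw [cornerSum_col t q (by omega), i0, ih k, prod_range_succ]
      ring

theorem sum_exc_inv_eq_pathSum (t q : ℤ) (n : ℕ) :
    (∑ σ : Equiv.Perm (Fin (n + 1)), t ^ excN σ * q ^ (invN σ - excN σ)) =
      pathSum t q (n + 1) 1 := by
  have := cornerSum_eq_pathSum t q n 0
  rw [cornerSum_zero_left, cornerSum_zero_zero] at this
  simpa using this

/-- The position of the value `v` in the word `σ(1)…σ(n)0`. -/
def valPos {n : ℕ} (σ : Equiv.Perm (Fin n)) (v : ℕ) : ℕ :=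
  if h : 0 < v ∧ v ≤ n then (σ.symm ⟨v - 1, by omega⟩ : ℕ) else n

lemma wrd_le {n : ℕ} (σ : Equiv.Perm (Fin n)) (i : ℕ) : wrd σ i ≤ n := by
  unfold wrd
  split_ifs <;> omega

lemma wrd_pos {n : ℕ} (σ : Equiv.Perm (Fin n)) {i : ℕ} (hi : i < n) : 0 < wrd σ i := by
  simp [wrd, hi]

lemma wrd_of_le {n : ℕ} (σ : Equiv.Perm (Fin n)) {i : ℕ} (hi : n ≤ i) : wrd σ i = 0 := by
  simp [wrd, hi.not_gt]

lemma valPos_lt {n : ℕ} (σ : Equiv.Perm (Fin n)) {v : ℕ} (h0 : 0 < v) (hv : v ≤ n) :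
    valPos σ v < n := by
  simp [valPos, h0, hv]

lemma valPos_le {n : ℕ} (σ : Equiv.Perm (Fin n)) (v : ℕ) : valPos σ v ≤ n := by
  unfold valPos
  split_ifs <;> omega

lemma valPos_zero {n : ℕ} (σ : Equiv.Perm (Fin n)) : valPos σ 0 = n := by
  simp [valPos]

lemma wrd_valPos {n : ℕ} (σ : Equiv.Perm (Fin n)) {v : ℕ} (hv : v ≤ n) :
    wrd σ (valPos σ v) = v := by
  rcases Nat.eq_zero_or_pos v with rfl | h0
  · rw [valPos_zero, wrd_of_le σ le_rfl]
  · have : valPos σ v < n := valPos_lt σ h0 hv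
    simp [wrd, valPos, h0, hv]
    omega

lemma valPos_wrd {n : ℕ} (σ : Equiv.Perm (Fin n)) {i : ℕ} (hi : i ≤ n) :
    valPos σ (wrd σ i) = i := by
  rcases hi.eq_or_lt with rfl | h
  · rw [wrd_of_le σ le_rfl, valPos_zero]
  · have h1 := wrd_pos σ h
    have h2 := wrd_le σ i
    rw [valPos, dif_pos ⟨h1, h2⟩]
    simp [wrd, h]

lemma wrd_eq_iff {n : ℕ} (σ : Equiv.Perm (Fin n)) {i v : ℕ} (hi : i ≤ n) (hv : v ≤ n) :
    wrd σ i = v ↔ i = valPos σ v :=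
  ⟨fun h => by rw [← h, valPos_wrd σ hi], fun h => by rw [h, wrd_valPos σ hv]⟩

/-- The contribution of position `p` to `lesN`. -/
def lesAt {n : ℕ} (σ : Equiv.Perm (Fin n)) (p : ℕ) : ℕ :=
  ((Ico 1 n).filter fun i => i < p ∧ wrd σ i < wrd σ p ∧ wrd σ p < wrd σ (i - 1)).card

/-- The contribution of position `p` to `resN`. -/
def resAt {n : ℕ} (σ : Equiv.Perm (Fin n)) (p : ℕ) : ℕ :=
  ((range (n - 1)).filter fun j => p < j ∧ wrd σ j < wrd σ p ∧ wrd σ p < wrd σ (j + 1)).card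

/-- The number of maximal blocks of letters `≥ v` in the word `σ(1)…σ(n)0`. -/
def blocks {n : ℕ} (σ : Equiv.Perm (Fin n)) (v : ℕ) : ℕ :=
  ((range n).filter fun i => wrd σ (i + 1) < v ∧ v ≤ wrd σ i).card

lemma lesN_eq_sum {n : ℕ} (σ : Equiv.Perm (Fin n)) : lesN σ = ∑ p ∈ range n, lesAt σ p := by
  have h0 : lesAt σ 0 = 0 := by simp [lesAt]
  have h1 : ∑ p ∈ range n, lesAt σ p = ∑ p ∈ Ico 1 n, lesAt σ p := by
    symm
    refine sum_subset (fun x hx => by simp at hx ⊢; omega) fun x hx hx' => ?_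
    have : x = 0 := by simp at hx hx'; omega
    rw [this, h0]
  rw [h1]
  simp only [lesN, lesAt, card_filter]
  rw [sum_product_right]

lemma resN_eq_sum {n : ℕ} (σ : Equiv.Perm (Fin n)) : resN σ = ∑ p ∈ range n, resAt σ p := by
  have h1 : ∑ p ∈ range n, resAt σ p = ∑ p ∈ range (n - 1), resAt σ p := by
    symm
    refine sum_subset (fun x hx => by simp at hx ⊢; omega) fun x hx hx' => ?_
    rw [resAt, card_eq_zero, filter_eq_empty_iff]
    intro j hj
    simp at hx hx' hj
    omega
  rw [h1]
  simp only [resN, resAt, card_filter]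
  rw [sum_product]

lemma card_down_crossings (f : ℕ → ℕ) (v p : ℕ) : ∀ m,
    ((Ico p (p + m)).filter fun i => f (i + 1) < v ∧ v ≤ f i).card +
        (if v ≤ f (p + m) then 1 else 0) =
      ((Ico p (p + m)).filter fun i => f i < v ∧ v ≤ f (i + 1)).card +
        (if v ≤ f p then 1 else 0) := by
  intro m
  induction m with
  | zero => simp
  | succ m ih =>
    simp only [card_filter] at ih ⊢
    rw [← add_assoc, sum_Ico_succ_top (by omega), sum_Ico_succ_top (by omega)]
    split_ifs at ih ⊢ <;> omega

lemma blocks_eq {n : ℕ} (σ : Equiv.Perm (Fin n)) {v : ℕ} (h0 : 0 < v) (hv : v ≤ n) :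
    blocks σ v = lesAt σ (valPos σ v) + 1 + resAt σ (valPos σ v) := by
  have hp := valPos_lt σ h0 hv
  have hw := wrd_valPos σ hv
  set p := valPos σ v with hpdef
  have hne : ∀ i ≤ n, i ≠ p → wrd σ i ≠ v := fun i hi h1 h2 => h1 ((wrd_eq_iff σ hi hv).1 h2)
  have hsplit : blocks σ v =
      ((range p).filter fun i => wrd σ (i + 1) < v ∧ v ≤ wrd σ i).card +
      ((Ico p (p + (n - p))).filter fun i => wrd σ (i + 1) < v ∧ v ≤ wrd σ i).card := by
    simp only [blocks, card_filter]
    rw [show p + (n - p) = n by omega, sum_range_add_sum_Ico _ hp.le]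
  have hles : ((range p).filter fun i => wrd σ (i + 1) < v ∧ v ≤ wrd σ i).card = lesAt σ p := by
    refine card_nbij' (fun i => i + 1) (fun i => i - 1) ?_ ?_ ?_ ?_
    · intro i hi
      simp only [coe_filter, Set.mem_ofPred_eq, mem_range, mem_Ico, hw, Nat.add_sub_cancel] at hi ⊢
      have h1 := hne i (by omega) (by omega)
      have h2 : i + 1 ≠ p := fun h => by rw [h, hw] at hi; omega
      omega
    · intro i hi
      simp only [coe_filter, Set.mem_ofPred_eq, mem_range, mem_Ico, hw] at hi ⊢
      rw [Nat.sub_add_cancel hi.1.1]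
      omega
    · intro i _; simp
    · intro i hi
      simp only [coe_filter, Set.mem_ofPred_eq, mem_Ico] at hi
      simp only; omega
  have hres : ((Ico p (p + (n - p))).filter fun i => wrd σ i < v ∧ v ≤ wrd σ (i + 1)).card =
      resAt σ p := by
    rw [resAt]
    congr 1
    ext i
    simp only [mem_filter, mem_Ico, mem_range, hw]
    constructor
    · rintro ⟨h1, h2, h3⟩
      have h4 : i ≠ p := fun h => by rw [h, hw] at h2; omega
      have h5 : i + 1 ≠ n := fun h => by rw [h, wrd_of_le σ le_rfl] at h3; omega
      have h6 := hne (i + 1) (by omega) (by omega)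
      omega
    · omega
  have h := card_down_crossings (wrd σ) v p (n - p)
  rw [hres, hw, show p + (n - p) = n by omega, wrd_of_le σ le_rfl, if_neg (by omega),
    if_pos le_rfl] at h
  rw [hsplit, hles, show p + (n - p) = n by omega]
  omega

lemma blocks_succ {n : ℕ} (σ : Equiv.Perm (Fin n)) {v : ℕ} (h0 : 0 < v) (hv : v ≤ n) :
    blocks σ (v + 1) + (decide (wrd σ (valPos σ v + 1) < v)).toNat =
      blocks σ v + (decide (v < wrd σ (valPos σ v - 1))).toNat := by
  have hp := valPos_lt σ h0 hv
  have hw := wrd_valPos σ hv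
  set p := valPos σ v with hpdef
  have hR : (decide (wrd σ (p + 1) < v)).toNat =
      ∑ i ∈ range n, if wrd σ (i + 1) < v ∧ wrd σ i = v then 1 else 0 := by
    rw [sum_eq_single_of_mem p (mem_range.2 hp)]
    · by_cases h : wrd σ (p + 1) < v <;> simp [h, hw]
    · intro i hi hip
      exact if_neg fun h => hip ((wrd_eq_iff σ (mem_range.1 hi).le hv).1 h.2)
  have hL : (decide (v < wrd σ (p - 1))).toNat =
      ∑ i ∈ range n, if wrd σ (i + 1) = v ∧ v < wrd σ i then 1 else 0 := by
    rcases Nat.eq_zero_or_pos p with h | h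
    · rw [sum_eq_zero]
      · rw [h] at hw
        simp [h, hw]
      · intro i hi
        have := fun h => (wrd_eq_iff σ (i := i + 1) (mem_range.1 hi) hv).1 h
        exact if_neg fun h => by have := this h.1; omega
    · rw [sum_eq_single_of_mem (p - 1) (mem_range.2 (by omega))]
      · rw [Nat.sub_add_cancel h]
        by_cases h : v < wrd σ (p - 1) <;> simp [h, hw]
      · intro i hi hip
        have := fun h => (wrd_eq_iff σ (i := i + 1) (mem_range.1 hi) hv).1 h
        exact if_neg fun h => by have := this h.1; omega
  rw [hR, hL]
  simp only [blocks, card_filter, ← sum_add_distrib]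
  refine sum_congr rfl fun i _ => ?_
  split_ifs <;> omega

lemma blocks_one {n : ℕ} (hn : 1 ≤ n) (σ : Equiv.Perm (Fin n)) : blocks σ 1 = 1 := by
  rw [blocks, card_eq_one]
  refine ⟨n - 1, ?_⟩
  ext i
  simp only [mem_filter, mem_range, mem_singleton]
  constructor
  · rintro ⟨h1, h2, -⟩
    by_contra h
    have := wrd_pos σ (i := i + 1) (by omega)
    omega
  · rintro rfl
    refine ⟨by omega, ?_, wrd_pos σ (by omega)⟩
    rw [wrd_of_le σ (by omega)]
    omega

lemma blocks_top {n : ℕ} (σ : Equiv.Perm (Fin n)) : blocks σ (n + 1) = 0 := by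
  rw [blocks, card_eq_zero, filter_eq_empty_iff]
  intro i _
  have := wrd_le σ i
  omega

/-- The letter recorded for the value `v`: which block receives `v`, and whether its left
neighbour is larger and its right neighbour smaller. -/
def letter {n : ℕ} (σ : Equiv.Perm (Fin n)) (v : ℕ) : ℕ × Bool × Bool :=
  (lesAt σ (valPos σ v), decide (v < wrd σ (valPos σ v - 1)), decide (wrd σ (valPos σ v + 1) < v))

/-- The letters recorded for the values `v, …, v + m - 1`. -/
def letters {n : ℕ} (σ : Equiv.Perm (Fin n)) : ℕ → ℕ → List (ℕ × Bool × Bool)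
  | _, 0 => []
  | v, m + 1 => letter σ v :: letters σ (v + 1) m

/-- The Laguerre histories with `m` steps from height `s` to height `0`. -/
def histories : ℕ → ℕ → Finset (List (ℕ × Bool × Bool))
  | 0, s => if s = 0 then {[]} else ∅
  | m + 1, s => (range s ×ˢ univ).biUnion fun x =>
      (histories m (s + x.2.1.toNat - x.2.2.toNat)).image (List.cons x)

/-- The weight of a history starting from height `s`. -/
def historyWeight (q : ℤ) (ω : Bool → Bool → ℤ) : ℕ → List (ℕ × Bool × Bool) → ℤ
  | _, [] => 1
  | s, x :: l => q ^ (x.1 + 2 * (s - 1 - x.1)) * ω x.2.1 x.2.2 *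
      historyWeight q ω (s + x.2.1.toNat - x.2.2.toNat) l

lemma sum_historyWeight (t q : ℤ) (ω : Bool → Bool → ℤ) (h1 : ω true false = t)
    (h2 : ω false false + ω true true = 1 + t) (h3 : ω false true = 1) (m : ℕ) : ∀ s,
    ∑ l ∈ histories m s, historyWeight q ω s l = pathSum t q m s := by
  induction m with
  | zero =>
    intro s
    by_cases h : s = 0 <;> simp [histories, historyWeight, pathSum, h]
  | succ m ih =>
    intro s
    rw [histories, sum_biUnion]
    · have hstep : ∀ x : ℕ × Bool × Bool,
          ∑ l ∈ (histories m (s + x.2.1.toNat - x.2.2.toNat)).image (List.cons x),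
            historyWeight q ω s l = q ^ (x.1 + 2 * (s - 1 - x.1)) * (ω x.2.1 x.2.2 *
              pathSum t q m (s + x.2.1.toNat - x.2.2.toNat)) := by
        intro x
        rw [sum_image fun _ _ _ _ h => (List.cons.inj h).2, ← ih, mul_sum, mul_sum]
        refine sum_congr rfl fun l _ => ?_
        rw [historyWeight]
        ring
      simp only [hstep]
      rw [sum_product]
      simp only [← mul_sum]
      rw [← sum_mul]
      rcases s with _ | k
      · simp [pathSum]
      · rw [pathSum, stepWeight, ← sum_range_reflect]
        congr 1
        · refine sum_congr rfl fun i hi => ?_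
          rw [mem_range] at hi
          congr 1
          omega
        · rw [Fintype.sum_prod_type]
          simp only [Fintype.sum_bool, Bool.toNat_true, Bool.toNat_false, h1, h3,
            add_zero, Nat.add_sub_cancel, Nat.sub_zero]
          rw [← h2]
          ring
    · intro x _ y _ hxy
      rw [Function.onFun, disjoint_left]
      intro l hl hl'
      obtain ⟨a, -, rfl⟩ := mem_image.1 hl
      obtain ⟨b, -, h⟩ := mem_image.1 hl'
      exact hxy (List.cons.inj h).1.symm

lemma blocks_step {n : ℕ} (σ : Equiv.Perm (Fin n)) {v : ℕ} (h0 : 0 < v) (hv : v ≤ n) :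
    blocks σ v + (letter σ v).2.1.toNat - (letter σ v).2.2.toNat = blocks σ (v + 1) := by
  have := blocks_succ σ h0 hv
  simp only [letter]
  omega

lemma letters_mem_histories {n : ℕ} (σ : Equiv.Perm (Fin n)) (m : ℕ) : ∀ v, 0 < v →
    v + m = n + 1 → letters σ v m ∈ histories m (blocks σ v) := by
  induction m with
  | zero =>
    intro v h0 hv
    rw [show v = n + 1 by omega, blocks_top]
    simp [histories, letters]
  | succ m ih =>
    intro v h0 hv
    rw [histories, mem_biUnion]
    refine ⟨letter σ v, ?_, ?_⟩
    · have := blocks_eq σ h0 (by omega)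
      simp only [mem_product, mem_range, mem_univ, and_true, letter]
      omega
    · rw [blocks_step σ h0 (by omega), letters]
      exact mem_image_of_mem _ (ih (v + 1) (by omega) (by omega))

lemma historyWeight_letters {n : ℕ} (q : ℤ) (ω : Bool → Bool → ℤ) (σ : Equiv.Perm (Fin n))
    (m : ℕ) : ∀ v, 0 < v → v + m = n + 1 →
    historyWeight q ω (blocks σ v) (letters σ v m) =
      ∏ u ∈ Ico v (v + m), q ^ (lesAt σ (valPos σ u) + 2 * resAt σ (valPos σ u)) *
        ω (letter σ u).2.1 (letter σ u).2.2 := by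
  induction m with
  | zero => intro v _ _; simp [letters, historyWeight]
  | succ m ih =>
    intro v h0 hv
    rw [letters, historyWeight, blocks_step σ h0 (by omega), ih (v + 1) (by omega) (by omega),
      prod_eq_prod_Ico_succ_bot (by omega : v < v + (m + 1)),
      show v + 1 + m = v + (m + 1) by ring]
    congr 3
    have := blocks_eq σ h0 (by omega)
    simp only [letter]
    omega

lemma historyWeight_letters_one {n : ℕ} (hn : 1 ≤ n) (q : ℤ) (ω : Bool → Bool → ℤ)
    (σ : Equiv.Perm (Fin n)) :
    historyWeight q ω 1 (letters σ 1 n) = q ^ (2 * resN σ + lesN σ) *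
      ∏ p ∈ range n, ω (decide (wrd σ p < wrd σ (p - 1))) (decide (wrd σ (p + 1) < wrd σ p)) := by
  have h := historyWeight_letters q ω σ n 1 one_pos (by omega)
  rw [blocks_one hn] at h
  rw [h, resN_eq_sum, lesN_eq_sum, mul_sum, ← sum_add_distrib, ← prod_pow_eq_pow_sum,
    ← prod_mul_distrib]
  refine prod_nbij' (valPos σ) (wrd σ) ?_ ?_ ?_ ?_ ?_
  · intro u hu
    rw [mem_Ico] at hu
    exact mem_range.2 (valPos_lt σ (by omega) (by omega))
  · intro p hp
    rw [mem_range] at hp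
    have := wrd_pos σ hp
    have := wrd_le σ p
    exact mem_Ico.2 (by omega)
  · intro u hu
    rw [mem_Ico] at hu
    exact wrd_valPos σ (by omega)
  · intro p hp
    exact valPos_wrd σ (mem_range.1 hp).le
  · intro u hu
    rw [mem_Ico] at hu
    rw [wrd_valPos σ (by omega), add_comm (lesAt _ _), letter]

/-- The left neighbour of the value `x` is at least `v`. -/
def ClosesBlock {n : ℕ} (σ : Equiv.Perm (Fin n)) (v x : ℕ) : Prop :=
  0 < valPos σ x ∧ v ≤ wrd σ (valPos σ x - 1)

lemma valPos_injOn {n : ℕ} (σ : Equiv.Perm (Fin n)) {x y : ℕ} (hx : x ≤ n) (hy : y ≤ n)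
    (h : valPos σ x = valPos σ y) : x = y := by
  rw [← wrd_valPos σ hx, h, wrd_valPos σ hy]

lemma exists_closesBlock {n : ℕ} (σ : Equiv.Perm (Fin n)) {v x : ℕ} (hv : v ≤ n)
    (hx : x < v) (h : valPos σ v < valPos σ x) :
    ∃ z < v, ClosesBlock σ v z ∧ valPos σ v < valPos σ z ∧ valPos σ z ≤ valPos σ x := by
  classical
  have hex : ∃ j, valPos σ v < j ∧ wrd σ j < v :=
    ⟨valPos σ x, h, by rwa [wrd_valPos σ (by omega)]⟩
  have hle : Nat.find hex ≤ valPos σ x :=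
    Nat.find_min' hex ⟨h, by rwa [wrd_valPos σ (by omega)]⟩
  obtain ⟨h1, h2⟩ := Nat.find_spec hex
  have hmin := fun {m : ℕ} (hm : m < Nat.find hex) => Nat.find_min hex hm
  set j := Nat.find hex
  have hj : valPos σ (wrd σ j) = j := valPos_wrd σ (hle.trans (valPos_le σ x))
  refine ⟨wrd σ j, h2, ⟨by omega, ?_⟩, by rwa [hj], by rwa [hj]⟩
  rw [hj]
  rcases eq_or_ne (j - 1) (valPos σ v) with h3 | h3
  · rw [h3, wrd_valPos σ hv]
  · by_contra h4
    exact hmin (m := j - 1) (by omega) ⟨by omega, by omega⟩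

open Classical in
lemma lesAt_valPos {n : ℕ} (σ : Equiv.Perm (Fin n)) {v : ℕ} (h0 : 0 < v) (hv : v ≤ n) :
    lesAt σ (valPos σ v) =
      ((range v).filter fun x => ClosesBlock σ v x ∧ valPos σ x < valPos σ v).card := by
  have hp := valPos_lt σ h0 hv
  refine card_nbij' (wrd σ) (valPos σ) ?_ ?_ ?_ ?_
  · intro i hi
    simp only [coe_filter, Set.mem_ofPred_eq, mem_range, mem_Ico, wrd_valPos σ hv] at hi ⊢
    rw [ClosesBlock, valPos_wrd σ (by omega)]
    exact ⟨hi.2.2.1, ⟨by omega, by omega⟩, by omega⟩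
  · intro x hx
    simp only [coe_filter, Set.mem_ofPred_eq, mem_range, mem_Ico, wrd_valPos σ hv] at hx ⊢
    obtain ⟨hx, ⟨hx1, hx2⟩, hx3⟩ := hx
    rw [wrd_valPos σ (by omega)]
    have : wrd σ (valPos σ x - 1) ≠ v := by
      rw [Ne, wrd_eq_iff σ (by omega) hv]
      omega
    omega
  · intro i hi
    simp only [coe_filter, Set.mem_ofPred_eq, mem_Ico] at hi
    exact valPos_wrd σ (by omega)
  · intro x hx
    simp only [coe_filter, Set.mem_ofPred_eq, mem_range] at hx
    exact wrd_valPos σ (by omega)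

/-- The relative order of the values below `v`, and the blocks between them, agree. -/
def AgreeBelow {n : ℕ} (σ τ : Equiv.Perm (Fin n)) (v : ℕ) : Prop :=
  (∀ x < v, ∀ y < v, valPos σ x < valPos σ y ↔ valPos τ x < valPos τ y) ∧
    ∀ x < v, ClosesBlock σ v x ↔ ClosesBlock τ v x

lemma AgreeBelow.symm {n : ℕ} {σ τ : Equiv.Perm (Fin n)} {v : ℕ} (h : AgreeBelow σ τ v) :
    AgreeBelow τ σ v :=
  ⟨fun x hx y hy => (h.1 x hx y hy).symm, fun x hx => (h.2 x hx).symm⟩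

lemma agreeBelow_one {n : ℕ} (hn : 1 ≤ n) (σ τ : Equiv.Perm (Fin n)) : AgreeBelow σ τ 1 := by
  constructor
  · intro x hx y hy
    obtain rfl : x = y := by omega
    simp
  · intro x hx
    obtain rfl : x = 0 := by omega
    have h1 := wrd_pos σ (i := n - 1) (by omega)
    have h2 := wrd_pos τ (i := n - 1) (by omega)
    simp only [ClosesBlock, valPos_zero]
    omega

lemma AgreeBelow.valPos_lt_of_lt {n : ℕ} {σ τ : Equiv.Perm (Fin n)} {v : ℕ}
    (h : AgreeBelow σ τ v) (h0 : 0 < v) (hv : v ≤ n)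
    (hles : lesAt σ (valPos σ v) = lesAt τ (valPos τ v)) {x : ℕ} (hx : x < v)
    (hlt : valPos σ v < valPos σ x) : valPos τ v < valPos τ x := by
  classical
  by_contra hcon
  have hcon : valPos τ x < valPos τ v :=
    lt_of_le_of_ne (not_lt.1 hcon) fun e => hx.ne (valPos_injOn τ (by omega) hv e)
  obtain ⟨z, hz, hzc, hz1, hz2⟩ := exists_closesBlock σ hv hx hlt
  have hz3 : valPos τ z < valPos τ v := by
    have := h.1 x hx z hz
    omega
  rw [lesAt_valPos σ h0 hv, lesAt_valPos τ h0 hv] at hles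
  refine hles.not_lt (card_lt_card ?_)
  rw [ssubset_iff_of_subset]
  · refine ⟨z, ?_, ?_⟩
    · simp only [mem_filter, mem_range]
      exact ⟨hz, (h.2 z hz).1 hzc, hz3⟩
    · simp only [mem_filter, not_and, not_lt]
      intros
      omega
  · intro w hw
    simp only [mem_filter, mem_range] at hw ⊢
    have := h.1 w hw.1 z hz
    exact ⟨hw.1, (h.2 w hw.1).1 hw.2.1, by omega⟩

lemma succ_valPos_iff {n : ℕ} (σ : Equiv.Perm (Fin n)) {v x : ℕ} (h0 : 0 < v) (hv : v ≤ n)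
    (hx : x < v) :
    valPos σ x = valPos σ v + 1 ↔ wrd σ (valPos σ v + 1) < v ∧ valPos σ v < valPos σ x ∧
      ∀ y < v, ¬ (valPos σ v < valPos σ y ∧ valPos σ y < valPos σ x) := by
  have hp := valPos_lt σ h0 hv
  constructor
  · intro h
    refine ⟨?_, by omega, fun y _ => by omega⟩
    rw [← h, wrd_valPos σ (by omega)]
    exact hx
  · rintro ⟨h1, h2, h3⟩
    have := h3 _ h1
    rw [valPos_wrd σ hp] at this
    omega

lemma closesBlock_succ {n : ℕ} (σ : Equiv.Perm (Fin n)) {v x : ℕ} (hv : v ≤ n) :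
    ClosesBlock σ (v + 1) x ↔ ClosesBlock σ v x ∧ ¬ valPos σ x = valPos σ v + 1 := by
  have h1 := valPos_le σ x
  have h2 := wrd_eq_iff σ (i := valPos σ x - 1) (by omega) hv
  simp only [ClosesBlock]
  omega

lemma AgreeBelow.succ {n : ℕ} {σ τ : Equiv.Perm (Fin n)} {v : ℕ} (h : AgreeBelow σ τ v)
    (h0 : 0 < v) (hv : v ≤ n) (hl : letter σ v = letter τ v) : AgreeBelow σ τ (v + 1) := by
  simp only [letter, Prod.mk.injEq, decide_eq_decide] at hl
  obtain ⟨hles, hL, hR⟩ := hl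
  have hgt : ∀ x < v, valPos σ v < valPos σ x ↔ valPos τ v < valPos τ x := fun x hx =>
    ⟨h.valPos_lt_of_lt h0 hv hles hx, h.symm.valPos_lt_of_lt h0 hv hles.symm hx⟩
  have hlt : ∀ x < v, valPos σ x < valPos σ v ↔ valPos τ x < valPos τ v := by
    intro x hx
    have h1 := hgt x hx
    have h2 : valPos σ x ≠ valPos σ v := fun e => hx.ne (valPos_injOn σ (by omega) hv e)
    have h3 : valPos τ x ≠ valPos τ v := fun e => hx.ne (valPos_injOn τ (by omega) hv e)
    omega
  constructor
  · intro x hx y hy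
    rcases Nat.lt_succ_iff_lt_or_eq.1 hx with hx | rfl <;>
      rcases Nat.lt_succ_iff_lt_or_eq.1 hy with hy | rfl
    · exact h.1 x hx y hy
    · exact hlt x hx
    · exact hgt y hy
    · simp
  · intro x hx
    rcases Nat.lt_succ_iff_lt_or_eq.1 hx with hx | rfl
    · rw [closesBlock_succ σ hv, closesBlock_succ τ hv, h.2 x hx, succ_valPos_iff σ h0 hv hx,
        succ_valPos_iff τ h0 hv hx, hR, hgt x hx]
      have : ∀ y < v, (valPos σ v < valPos σ y ∧ valPos σ y < valPos σ x) ↔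
          (valPos τ v < valPos τ y ∧ valPos τ y < valPos τ x) := fun y hy => by
        rw [hgt y hy, h.1 y hy x hx]
      rw [forall₂_congr fun y hy => not_congr (this y hy)]
    · have key : ∀ ρ : Equiv.Perm (Fin n), ClosesBlock ρ (x + 1) x ↔
          x < wrd ρ (valPos ρ x - 1) := by
        intro ρ
        refine ⟨fun hc => hc.2, fun hc => ⟨Nat.pos_of_ne_zero fun hz => ?_, hc⟩⟩
        have := wrd_valPos ρ hv
        rw [hz] at hc this
        simp [this] at hc
      rw [key, key, hL]

lemma eq_of_agreeBelow {n : ℕ} {σ τ : Equiv.Perm (Fin n)} (h : AgreeBelow σ τ (n + 1)) :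
    σ = τ := by
  have hval : ∀ (ρ : Equiv.Perm (Fin n)) (i : Fin n), valPos ρ ((ρ i : ℕ) + 1) = i := by
    intro ρ i
    have := valPos_wrd ρ i.2.le
    rwa [wrd, dif_pos i.2] at this
  have hmono : StrictMono fun i => τ.symm (σ i) := by
    intro i j hij
    have h1 := (h.1 (σ i + 1) (by omega) (σ j + 1) (by omega)).1 (by rw [hval, hval]; exact hij)
    have h2 := hval τ (τ.symm (σ i))
    have h3 := hval τ (τ.symm (σ j))
    rw [τ.apply_symm_apply] at h2 h3
    rw [h2, h3] at h1
    exact h1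
  have hid : (fun i => τ.symm (σ i)) = id :=
    (hmono.range_inj strictMono_id).1 (by
      rw [Set.range_id]
      exact (τ.symm.surjective.comp σ.surjective).range_eq)
  ext i
  have := congrFun hid i
  simp only [id, Equiv.symm_apply_eq] at this
  rw [this]

lemma agreeBelow_of_letters {n : ℕ} {σ τ : Equiv.Perm (Fin n)} (m : ℕ) : ∀ v, 0 < v →
    v + m = n + 1 → letters σ v m = letters τ v m → AgreeBelow σ τ v →
    AgreeBelow σ τ (n + 1) := by
  induction m with
  | zero =>
    intro v _ hv _ h
    rwa [← hv]
  | succ m ih =>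
    intro v h0 hv hl h
    obtain ⟨hl, hl'⟩ := List.cons.inj hl
    exact ih (v + 1) (by omega) (by omega) hl' (h.succ h0 (by omega) hl)

lemma letters_injective {n : ℕ} (hn : 1 ≤ n) :
    Function.Injective fun σ : Equiv.Perm (Fin n) => letters σ 1 n := fun σ τ h =>
  eq_of_agreeBelow (agreeBelow_of_letters n 1 one_pos (by omega) h (agreeBelow_one hn σ τ))

lemma card_histories (n : ℕ) : (histories (n + 1) 1).card = (n + 1).factorial := by
  have hw : ∀ l s, historyWeight 1 (fun _ _ => 1) s l = 1 := by
    intro l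
    induction l with
    | nil => intro s; rfl
    | cons x l ih => intro s; simp [historyWeight, ih]
  have h1 := sum_historyWeight 1 1 (fun _ _ => 1) rfl (by norm_num) rfl (n + 1) 1
  rw [← sum_exc_inv_eq_pathSum] at h1
  simp only [hw, one_pow, mul_one, sum_const, card_univ, Fintype.card_perm, Fintype.card_fin,
    nsmul_eq_mul] at h1
  exact_mod_cast h1

lemma image_letters {n : ℕ} (hn : 1 ≤ n) :
    univ.image (fun σ : Equiv.Perm (Fin n) => letters σ 1 n) = histories n 1 := by
  refine eq_of_subset_of_card_le ?_ ?_
  · intro l hl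
    obtain ⟨σ, -, rfl⟩ := mem_image.1 hl
    have := letters_mem_histories σ n 1 one_pos (by omega)
    rwa [blocks_one hn] at this
  · rw [card_image_of_injective _ (letters_injective hn), card_univ, Fintype.card_perm,
      Fintype.card_fin]
    obtain ⟨m, rfl⟩ : ∃ m, n = m + 1 := ⟨n - 1, by omega⟩
    rw [card_histories]

lemma card_left_larger {n : ℕ} (σ : Equiv.Perm (Fin n)) :
    ((range n).filter fun p => wrd σ p < wrd σ (p - 1)).card = desN σ := by
  symm
  refine card_nbij' (fun i => i + 1) (fun i => i - 1) ?_ ?_ ?_ ?_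
  · intro i hi
    simp only [coe_filter, Set.mem_ofPred_eq, mem_range, Nat.add_sub_cancel] at hi ⊢
    exact ⟨by omega, hi.2⟩
  · intro i hi
    simp only [coe_filter, Set.mem_ofPred_eq, mem_range] at hi ⊢
    have : i ≠ 0 := by rintro rfl; simp at hi
    rw [Nat.sub_add_cancel (by omega)]
    exact ⟨by omega, hi.2⟩
  · intro i _; simp
  · intro i hi
    simp only [coe_filter, Set.mem_ofPred_eq] at hi
    have : i ≠ 0 := by rintro rfl; simp at hi
    simp only
    omega

lemma card_right_smaller {n : ℕ} (hn : 1 ≤ n) (σ : Equiv.Perm (Fin n)) :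
    ((range n).filter fun p => wrd σ (p + 1) < wrd σ p).card = desN σ + 1 := by
  obtain ⟨m, rfl⟩ : ∃ m, n = m + 1 := ⟨n - 1, by omega⟩
  have h1 := wrd_pos σ (i := m) (by omega)
  have h2 := wrd_of_le σ (i := m + 1) le_rfl
  rw [range_add_one, filter_insert, if_pos (by omega), card_insert_of_notMem (by simp), desN,
    Nat.add_sub_cancel]

/-- The local weight of a permutation without double descents: `t` per valley and `1 + t` per
double ascent. -/
def gammaWeight (t : ℤ) : Bool → Bool → ℤ
  | true, false => t
  | false, false => 1 + t
  | false, true => 1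
  | true, true => 0

lemma prod_gammaWeight_of_ne {n : ℕ} (t : ℤ) {σ : Equiv.Perm (Fin n)} (h : ddN σ ≠ 0) :
    ∏ p ∈ range n, gammaWeight t (decide (wrd σ p < wrd σ (p - 1)))
      (decide (wrd σ (p + 1) < wrd σ p)) = 0 := by
  obtain ⟨p, hp⟩ := card_ne_zero.1 h
  simp only [mem_filter, mem_Ico] at hp
  refine prod_eq_zero (mem_range.2 hp.1.2) ?_
  simp [hp.2.1, hp.2.2, gammaWeight]

lemma prod_gammaWeight {n : ℕ} (hn : 1 ≤ n) (t : ℤ) {σ : Equiv.Perm (Fin n)} (h : ddN σ = 0) :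
    2 * desN σ + 1 ≤ n ∧ ∏ p ∈ range n, gammaWeight t (decide (wrd σ p < wrd σ (p - 1)))
      (decide (wrd σ (p + 1) < wrd σ p)) = t ^ desN σ * (1 + t) ^ (n - 1 - 2 * desN σ) := by
  have hdd : ∀ p ∈ range n, ¬ (wrd σ p < wrd σ (p - 1) ∧ wrd σ (p + 1) < wrd σ p) := by
    intro p hp hcon
    have h0 : p ≠ 0 := by rintro rfl; simp at hcon
    rw [ddN, card_eq_zero, filter_eq_empty_iff] at h
    exact h (mem_Ico.2 ⟨by omega, mem_range.1 hp⟩) ⟨hcon.2, hcon.1⟩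
  have hcount : ((range n).filter fun p => wrd σ p < wrd σ (p - 1)).card +
      ((range n).filter fun p => wrd σ (p + 1) < wrd σ p).card +
      ((range n).filter fun p => ¬ wrd σ p < wrd σ (p - 1) ∧ ¬ wrd σ (p + 1) < wrd σ p).card
        = n := by
    simp only [card_filter, ← sum_add_distrib]
    refine Eq.trans (sum_congr rfl fun p hp => ?_) (by simp : ∑ p ∈ range n, 1 = n)
    have := hdd p hp
    split_ifs <;> omega
  have hr := card_right_smaller hn σ
  have hl := card_left_larger σ
  refine ⟨by omega, ?_⟩
  have e1 : n - 1 - 2 * desN σ = ((range n).filter fun p =>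
      ¬ wrd σ p < wrd σ (p - 1) ∧ ¬ wrd σ (p + 1) < wrd σ p).card := by omega
  rw [e1, ← hl, card_filter, card_filter, ← prod_pow_eq_pow_sum, ← prod_pow_eq_pow_sum,
    ← prod_mul_distrib]
  refine prod_congr rfl fun p hp => ?_
  have := hdd p hp
  by_cases h1 : wrd σ p < wrd σ (p - 1) <;> by_cases h2 : wrd σ (p + 1) < wrd σ p
  · exact absurd ⟨h1, h2⟩ this
  all_goals simp [h1, h2, gammaWeight]

lemma sum_gamma_eq_pathSum {n : ℕ} (hn : 1 ≤ n) (t q : ℤ) :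
    ∑ k ∈ range ((n - 1) / 2 + 1),
        (∑ σ ∈ DDset n k, q ^ (2 * resN σ + lesN σ)) * t ^ k * (1 + t) ^ (n - 1 - 2 * k) =
      pathSum t q n 1 := by
  rw [← sum_historyWeight t q (gammaWeight t) rfl (by simp [gammaWeight]) rfl, ← image_letters hn,
    sum_image fun _ _ _ _ h => letters_injective hn h]
  simp only [historyWeight_letters_one hn, DDset, sum_mul, sum_filter]
  rw [sum_comm]
  refine sum_congr rfl fun σ _ => ?_
  by_cases h : ddN σ = 0
  · obtain ⟨hle, hprod⟩ := prod_gammaWeight hn t h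
    rw [hprod, sum_eq_single_of_mem (desN σ) (mem_range.2 (by omega))]
    · rw [if_pos ⟨rfl, h⟩, mul_assoc]
    · intro k _ hk
      rw [if_neg fun h' => hk h'.1.symm, zero_mul, zero_mul]
  · simp [prod_gammaWeight_of_ne t h, h]

theorem stmt1 (n : ℕ) (hn : 1 ≤ n) (t q : ℤ) :
    (∑ σ : Equiv.Perm (Fin n), t ^ excN σ * q ^ (invN σ - excN σ)) =
      ∑ k ∈ Finset.range ((n - 1) / 2 + 1),
        (∑ σ ∈ DDset n k, q ^ (2 * resN σ + lesN σ)) * t ^ k * (1 + t) ^ (n - 1 - 2 * k) := by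
  rw [sum_gamma_eq_pathSum hn]
  obtain ⟨m, rfl⟩ : ∃ m, n = m + 1 := ⟨n - 1, by omega⟩
  exact sum_exc_inv_eq_pathSum t q m
end

section
/- For every n ≥ 1 and 0 ≤ k ≤ ⌊(n-1)/2⌋, the polynomial γ_{n,k}(q) = Σ_{σ∈DD_{n,k}} q^{2·res σ + les σ} is divisible by q^k (1+q)^k in ℤ[q]. -/
open Finset

/-- Number of consecutive pairs `(b, a)` of the word `q R` with `b < x < a`. -/
def ascStr (x : ℕ) : ℕ → List ℕ → ℕ
  | _, [] => 0
  | q, b :: t => (if q < x ∧ x < b then 1 else 0) + ascStr x b t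

/-- Number of occurrences of the vincular pattern 2-13 in a word. -/
def patCount : List ℕ → ℕ
  | [] => 0
  | x :: t => ascStr x x t + patCount t

/-- Number of descents of the word `q u`. -/
def descCount : ℕ → List ℕ → ℕ
  | _, [] => 0
  | q, b :: t => (if b < q then 1 else 0) + descCount b t

/-- The windows `a b c` allowed: no two adjacent zeros `b`, `c` and no double descent. -/
def Allowed (a b c : ℕ) : Prop := (b ≠ 0 ∨ c ≠ 0) ∧ ¬ (c < b ∧ b < a)

/-- All windows of length three of the word `p q u` are allowed. -/
def AllAllowed : ℕ → ℕ → List ℕ → Prop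
  | _, _, [] => True
  | p, q, x :: t => Allowed p q x ∧ AllAllowed q x t

/-- The exponent `2 · (2-13) + (31-2)` of a word. -/
def stat (u : List ℕ) : ℕ := 2 * patCount u + patCount u.reverse

lemma ascStr_zero (q : ℕ) (R : List ℕ) : ascStr 0 q R = 0 := by
  induction R generalizing q with
  | nil => rfl
  | cons b t ih => simp [ascStr, ih]

lemma ascStr_prev {x q q' : ℕ} (h : q < x ↔ q' < x) (R : List ℕ) :
    ascStr x q R = ascStr x q' R := by
  cases R <;> simp [ascStr, h]

lemma ascStr_append_congr {x : ℕ} {A B : List ℕ} (h : ∀ q, ascStr x q A = ascStr x q B)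
    (q : ℕ) (P : List ℕ) : ascStr x q (P ++ A) = ascStr x q (P ++ B) := by
  induction P generalizing q with
  | nil => exact h q
  | cons b t ih => simp [ascStr, ih]

lemma patCount_append_congr {A B : List ℕ} {c : ℕ} (P : List ℕ)
    (h : ∀ x ∈ P, ∀ q, ascStr x q A = ascStr x q B) (hc : patCount A = patCount B + c) :
    patCount (P ++ A) = patCount (P ++ B) + c := by
  induction P with
  | nil => exact hc
  | cons b t ih =>
    simp only [List.cons_append, patCount]
    rw [ih (fun x hx => h x (List.mem_cons_of_mem _ hx)),
      ascStr_append_congr (h b List.mem_cons_self)]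
    ring

lemma patCount_zero_cons (R : List ℕ) : patCount (0 :: R) = patCount R := by
  simp [patCount, ascStr_zero]

section Insertion

variable {v : ℕ} {P Q : List ℕ}

lemma patCount_insert_mid (hP : ∀ x ∈ P, x = 0 ∨ v < x) :
    patCount (P ++ v :: Q) = patCount (P ++ 0 :: Q) + ascStr v v Q := by
  refine patCount_append_congr P (fun x hx q => ?_) (by rw [patCount_zero_cons, patCount, add_comm])
  rcases hP x hx with rfl | h
  · simp [ascStr_zero]
  · rw [ascStr, ascStr, ascStr_prev (q := v) (q' := 0) (by omega)]
    simp [show ¬ x < v by omega]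

lemma patCount_insert_left (hP : ∀ x ∈ P, x = 0 ∨ v < x) :
    patCount (P ++ 0 :: v :: Q) = patCount (P ++ 0 :: Q) + ascStr v v Q := by
  refine patCount_append_congr P (fun x hx q => ?_)
    (by rw [patCount_zero_cons, patCount_zero_cons, patCount, add_comm])
  rcases hP x hx with rfl | h
  · simp [ascStr_zero]
  · rw [ascStr, ascStr, ascStr, ascStr_prev (q := v) (q' := 0) (by omega)]
    simp [h.le]

lemma patCount_insert_right (hP : ∀ x ∈ P, x = 0 ∨ v < x) :
    patCount (P ++ v :: 0 :: Q) = patCount (P ++ 0 :: Q) + ascStr v v (0 :: Q) := by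
  rw [patCount_insert_mid hP]
  congr 1
  refine (patCount_append_congr (c := 0) P (fun x hx q => ?_) (by simp [patCount_zero_cons]))
  simp [ascStr]

lemma patCount_insert_both (hP : ∀ x ∈ P, x = 0 ∨ v < x) :
    patCount (P ++ 0 :: v :: 0 :: Q) = patCount (P ++ 0 :: Q) + ascStr v v (0 :: Q) := by
  rw [patCount_insert_left hP]
  congr 1
  refine (patCount_append_congr (c := 0) P (fun x hx q => ?_) (by simp [patCount_zero_cons]))
  simp [ascStr]

end Insertion

lemma ascStr_eq_count {v : ℕ} (hv : 0 < v) (q : ℕ) (R : List ℕ)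
    (hc : List.IsChain (fun a b => a ≠ 0 ∨ b ≠ 0) (q :: R)) (hl : R.getLast? = some 0)
    (hR : ∀ x ∈ R, x = 0 ∨ v < x) (hq : q = 0 ∨ v ≤ q) :
    ascStr v q R + 1 = R.count 0 + if q = 0 then 1 else 0 := by
  induction R generalizing q with
  | nil => simp at hl
  | cons b t ih =>
    rw [List.isChain_cons_cons] at hc
    have hb := hR b List.mem_cons_self
    rcases t with _ | ⟨c, t⟩
    · simp at hl
      subst hl
      simp at hc
      simp [ascStr, hc]
    · have := ih b hc.2 (by simpa using hl) (fun x hx => hR x (List.mem_cons_of_mem _ hx))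
        (by omega)
      rw [ascStr, List.count_cons]
      simp only [beq_iff_eq]
      have h1 := hc.1
      split_ifs at this ⊢ <;> omega

lemma AllAllowed.isChain {p q : ℕ} {u : List ℕ} (h : AllAllowed p q u) :
    List.IsChain (fun a b => a ≠ 0 ∨ b ≠ 0) (q :: u) := by
  induction u generalizing p q with
  | nil => simp
  | cons b t ih => exact List.isChain_cons_cons.2 ⟨h.1.1, ih h.2⟩

lemma allAllowed_append_congr {A B : List ℕ} (h : ∀ p q, AllAllowed p q A ↔ AllAllowed p q B)
    (p q : ℕ) (P : List ℕ) : AllAllowed p q (P ++ A) ↔ AllAllowed p q (P ++ B) := by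
  induction P generalizing p q with
  | nil => exact h p q
  | cons b t ih => simp [AllAllowed, ih]

lemma allAllowed_peak {v : ℕ} (hv : 0 < v) (p q : ℕ) (L R : List ℕ) :
    AllAllowed p q (L ++ 0 :: v :: 0 :: R) ↔ AllAllowed p q (L ++ 0 :: R) := by
  refine allAllowed_append_congr (fun p q => ?_) p q L
  rcases R with _ | ⟨b, R⟩ <;> simp [AllAllowed, Allowed, hv.ne']

lemma allAllowed_ascent {v b : ℕ} (hv : 0 < v) (hb : v < b) (p q : ℕ) (L R : List ℕ) :
    AllAllowed p q (L ++ 0 :: v :: b :: R) ↔ AllAllowed p q (L ++ 0 :: b :: R) := by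
  refine allAllowed_append_congr (fun p q => ?_) p q L
  have : b ≠ 0 := by omega
  rcases R with _ | ⟨c, R⟩ <;> simp [AllAllowed, Allowed, hv.ne', hb.le, this]

lemma allAllowed_valley {v a b : ℕ} (hv : 0 < v) (ha : v < a) (hb : v < b) (p q : ℕ)
    (L R : List ℕ) :
    AllAllowed p q (L ++ a :: v :: b :: R) ↔ AllAllowed p q (L ++ a :: 0 :: b :: R) := by
  refine allAllowed_append_congr (fun p q => ?_) p q L
  have : b ≠ 0 := by omega
  have : a ≠ 0 := by omega
  have : 0 < a := by omega
  rcases R with _ | ⟨c, R⟩ <;> simp [AllAllowed, Allowed, hv.ne', hb.le, *]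

lemma not_allAllowed_descent {v a : ℕ} (hv : 0 < v) (ha : v < a) (p q : ℕ) (L R : List ℕ) :
    ¬ AllAllowed p q (L ++ a :: v :: 0 :: R) := by
  induction L generalizing p q with
  | nil => simp [AllAllowed, Allowed, hv, ha]
  | cons b t ih => simp [AllAllowed, ih]

lemma descCount_append_congr {A B : List ℕ} {c : ℕ} (h : ∀ q, descCount q A = descCount q B + c)
    (q : ℕ) (P : List ℕ) : descCount q (P ++ A) = descCount q (P ++ B) + c := by
  induction P generalizing q with
  | nil => exact h q
  | cons b t ih => simp [descCount, ih, add_assoc]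

lemma descCount_peak {v : ℕ} (hv : 0 < v) (q : ℕ) (L R : List ℕ) :
    descCount q (L ++ 0 :: v :: 0 :: R) = descCount q (L ++ 0 :: R) + 1 := by
  refine descCount_append_congr (fun q => ?_) q L
  simp [descCount, hv]
  ring

lemma descCount_ascent {v b : ℕ} (hb : v < b) (q : ℕ) (L R : List ℕ) :
    descCount q (L ++ 0 :: v :: b :: R) = descCount q (L ++ 0 :: b :: R) := by
  refine descCount_append_congr (c := 0) (fun q => ?_) q L
  simp [descCount, hb.le]

lemma descCount_valley {v a b : ℕ} (ha : v < a) (hb : v < b) (q : ℕ) (L R : List ℕ) :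
    descCount q (L ++ a :: v :: b :: R) = descCount q (L ++ a :: 0 :: b :: R) := by
  refine descCount_append_congr (c := 0) (fun q => ?_) q L
  simp [descCount, hb.le, ha, show 0 < a by omega]

lemma append_zero_cons_inj {P Q P' Q' : List ℕ} (h : P ++ 0 :: Q = P' ++ 0 :: Q')
    (hc : P.count 0 = P'.count 0) : P = P' ∧ Q = Q' := by
  induction P generalizing P' with
  | nil =>
    rcases P' with _ | ⟨b, P'⟩
    · simpa using h
    · simp at h
      simp [← h.1] at hc
  | cons a P ih =>
    rcases P' with _ | ⟨b, P'⟩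
    · simp at h
      simp [h.1] at hc
    · simp only [List.cons_append, List.cons.injEq] at h
      obtain ⟨rfl, h⟩ := h
      have := ih h (by simpa [List.count_cons] using hc)
      simpa using this

lemma exists_split_zero {u : List ℕ} {i : ℕ} (h : i < u.count 0) :
    ∃ P Q, u = P ++ 0 :: Q ∧ P.count 0 = i := by
  induction u generalizing i with
  | nil => simp at h
  | cons a u ih =>
    by_cases ha : a = 0
    · subst ha
      rcases i with _ | i
      · exact ⟨[], u, rfl, rfl⟩
      · obtain ⟨P, Q, rfl, hP⟩ := ih (i := i) (by simpa using h)
        exact ⟨0 :: P, Q, rfl, by simp [hP]⟩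
    · obtain ⟨P, Q, rfl, hP⟩ := ih (i := i) (by simpa [List.count_cons, ha] using h)
      exact ⟨a :: P, Q, rfl, by simp [hP, ha]⟩

/-- `u` is a word `0 w₁ 0 w₂ 0 … w_h 0` with nonempty `wᵢ` whose nonzero letters are the elements
of `V`, each used once, with `d` descents and no double descent. -/
structure IsWord (V : Finset ℕ) (h d : ℕ) (u : List ℕ) : Prop where
  count_zero : u.count 0 = h + 1
  count_letter : ∀ x, x ≠ 0 → u.count x = if x ∈ V then 1 else 0
  head : u.head? = some 0
  last : u.getLast? = some 0
  allowed : AllAllowed 0 1 u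
  desc : descCount 0 u = d

open Classical in
/-- The finite set of the words satisfying `IsWord V h d`, for `0 ∉ V`. -/
noncomputable def words (V : Finset ℕ) (h d : ℕ) : Finset (List ℕ) :=
  (V.toList ++ List.replicate (h + 1) 0).permutations.toFinset.filter (IsWord V h d)

lemma mem_words {V : Finset ℕ} (hV : 0 ∉ V) {h d : ℕ} {u : List ℕ} :
    u ∈ words V h d ↔ IsWord V h d u := by
  classical
  simp only [words, mem_filter, List.mem_toFinset, List.mem_permutations, and_iff_right_iff_imp]
  intro hu
  rw [List.perm_iff_count]
  intro x
  by_cases hx : x = 0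
  · subst hx
    rw [hu.count_zero, List.count_append, List.count_replicate_self,
      List.count_eq_zero_of_not_mem (by simpa using hV), zero_add]
  · rw [hu.count_letter x hx, List.count_append, List.count_replicate,
      List.Nodup.count V.nodup_toList]
    simp [Ne.symm hx]

section Recursion

variable {V : Finset ℕ} {v : ℕ}

lemma IsWord.lt_of_mem {h d : ℕ} {u : List ℕ} (hu : IsWord V h d u) (hV : ∀ x ∈ V, v < x) :
    ∀ x ∈ u, x = 0 ∨ v < x := by
  intro x hx
  by_contra! hc
  have h1 := hu.count_letter x hc.1
  rw [if_neg (fun h => by have := hV x h; omega)] at h1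
  exact List.count_eq_zero.1 h1 hx

lemma IsWord.lt_of_insert {h d : ℕ} {L R : List ℕ} (hv : 0 < v)
    (hu : IsWord (insert v V) h d (L ++ v :: R)) (hV : ∀ x ∈ V, v < x) :
    (∀ x ∈ L, x = 0 ∨ v < x) ∧ ∀ x ∈ R, x = 0 ∨ v < x := by
  have hvc := hu.count_letter v hv.ne'
  simp only [List.count_append, List.count_cons_self, mem_insert_self, if_true] at hvc
  have key : ∀ x, x ∈ L ∨ x ∈ R → x = 0 ∨ v < x := by
    intro x hx
    by_contra! hc
    have hxv : x ≠ v := by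
      rintro rfl
      rcases hx with hx | hx <;> have := List.count_pos_iff.2 hx <;> omega
    have h1 := hu.count_letter x hc.1
    rw [if_neg (fun h => by
      rcases mem_insert.1 h with h | h
      · exact hxv h
      · have := hV x h; omega)] at h1
    have := List.count_eq_zero.1 h1
    simp at this
    tauto
  exact ⟨fun x hx => key x (.inl hx), fun x hx => key x (.inr hx)⟩

lemma isWord_insert_congr (hv : 0 < v) (hV : ∀ x ∈ V, v < x) {h d h' d' : ℕ} {u w : List ℕ}
    (hc : ∀ x, x ≠ 0 → u.count x = w.count x + if x = v then 1 else 0)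
    (hz : u.count 0 + h' = w.count 0 + h) (hhead : u.head? = w.head?)
    (hlast : u.getLast? = w.getLast?) (hall : AllAllowed 0 1 u ↔ AllAllowed 0 1 w)
    (hd : descCount 0 u + d' = descCount 0 w + d) :
    IsWord (insert v V) h d u ↔ IsWord V h' d' w := by
  have hl : (∀ x, x ≠ 0 → u.count x = if x ∈ insert v V then 1 else 0) ↔
      ∀ x, x ≠ 0 → w.count x = if x ∈ V then 1 else 0 := by
    refine forall_congr' fun x => imp_congr_right fun hx => ?_
    rw [hc x hx]
    have hvV : v ∉ V := fun h => lt_irrefl _ (hV v h)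
    by_cases hxv : x = v
    · subst hxv
      simp [hvV]
    · simp [hxv]
  exact ⟨fun hu => ⟨by have := hu.count_zero; omega, hl.1 hu.count_letter, hhead ▸ hu.head,
      hlast ▸ hu.last, hall.1 hu.allowed, by have := hu.desc; omega⟩,
    fun hu => ⟨by have := hu.count_zero; omega, hl.2 hu.count_letter, hhead ▸ hu.head,
      hlast ▸ hu.last, hall.2 hu.allowed, by have := hu.desc; omega⟩⟩

lemma isWord_peak (hv : 0 < v) (hV : ∀ x ∈ V, v < x) {h d : ℕ} {L R : List ℕ} :
    IsWord (insert v V) (h + 1) (d + 1) (L ++ 0 :: v :: 0 :: R) ↔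
      IsWord V h d (L ++ 0 :: R) := by
  refine isWord_insert_congr hv hV (fun x hx => ?_) ?_ (by cases L <;> rfl)
    (by simp [List.getLast?_append, List.getLast?_cons]) (allAllowed_peak hv 0 1 L R) ?_
  · simp only [List.count_append, List.count_cons, beq_iff_eq]
    split_ifs <;> omega
  · simp [hv.ne']
    omega
  · rw [descCount_peak hv]
    omega

lemma isWord_ascent (hv : 0 < v) (hV : ∀ x ∈ V, v < x) {h d b : ℕ} {L R : List ℕ} (hb : v < b) :
    IsWord (insert v V) h d (L ++ 0 :: v :: b :: R) ↔
      IsWord V h d (L ++ 0 :: b :: R) := by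
  refine isWord_insert_congr hv hV (fun x hx => ?_) ?_ (by cases L <;> rfl)
    (by simp [List.getLast?_append, List.getLast?_cons]) (allAllowed_ascent hv hb 0 1 L R) ?_
  · simp only [List.count_append, List.count_cons, beq_iff_eq]
    split_ifs <;> omega
  · simp [List.count_cons, hv.ne']
  · rw [descCount_ascent hb]

lemma isWord_valley (hv : 0 < v) (hV : ∀ x ∈ V, v < x) {h d a b : ℕ} {L R : List ℕ} (ha : v < a)
    (hb : v < b) :
    IsWord (insert v V) h d (L ++ a :: v :: b :: R) ↔
      IsWord V (h + 1) d (L ++ a :: 0 :: b :: R) := by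
  refine isWord_insert_congr hv hV (fun x hx => ?_) ?_ (by cases L <;> rfl)
    (by simp [List.getLast?_append, List.getLast?_cons]) (allAllowed_valley hv ha hb 0 1 L R) ?_
  · simp only [List.count_append, List.count_cons, beq_iff_eq]
    split_ifs <;> omega
  · simp [List.count_cons, hv.ne']
    omega
  · rw [descCount_valley ha hb]

lemma IsWord.ascStr_add_one {h d : ℕ} {L R : List ℕ} (hv : 0 < v)
    (hu : IsWord (insert v V) h d (L ++ v :: R)) (hV : ∀ x ∈ V, v < x) :
    ascStr v v R + 1 = R.count 0 ∧ ascStr v v L.reverse + 1 = L.count 0 := by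
  have hl := hu.lt_of_insert hv hV
  have hc := hu.allowed.isChain.tail
  simp only [List.tail_cons] at hc
  have hcr : List.IsChain (fun a b => a ≠ 0 ∨ b ≠ 0) (L ++ v :: R).reverse := by
    rw [List.isChain_reverse]
    exact hc.imp fun _ _ => Or.symm
  rw [List.reverse_append, List.reverse_cons, List.append_assoc] at hcr
  have hlast := hu.last
  have hhead := hu.head
  constructor
  · have := ascStr_eq_count hv v R hc.right_of_append ?_ hl.2 (.inr le_rfl)
    · simpa [hv.ne'] using this
    · rcases R with _ | ⟨b, R⟩
      · simp at hlast; omega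
      · simpa [List.getLast?_append, List.getLast?_cons] using hlast
  · have := ascStr_eq_count hv v L.reverse hcr.right_of_append ?_ (by simpa using hl.1)
      (.inr le_rfl)
    · simpa [hv.ne'] using this
    · rcases L with _ | ⟨b, L⟩
      · simp at hhead; omega
      · simpa using hhead

/-- Peak, ascent and valley: the three ways in which deleting the letter `v` of a word
can affect the adjacent zeros. -/
lemma IsWord.cases_insert {h d : ℕ} {L R : List ℕ} (hv : 0 < v)
    (hu : IsWord (insert v V) h d (L ++ v :: R)) (hV : ∀ x ∈ V, v < x) :
    (∃ L' R', L = L' ++ [0] ∧ R = 0 :: R') ∨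
      (∃ L' b R', v < b ∧ L = L' ++ [0] ∧ R = b :: R') ∨
      ∃ L' a b R', v < a ∧ v < b ∧ L = L' ++ [a] ∧ R = b :: R' := by
  have hl := hu.lt_of_insert hv hV
  have hlast := hu.last
  have hhead := hu.head
  rcases R with _ | ⟨b, R⟩
  · simp at hlast; omega
  rcases List.eq_nil_or_concat L with rfl | ⟨L, a, rfl⟩
  · simp at hhead; omega
  rw [List.concat_eq_append] at *
  have ha := hl.1 a (by simp)
  have hb := hl.2 b (by simp)
  rcases ha with rfl | ha <;> rcases hb with rfl | hb
  · exact .inl ⟨L, R, rfl, rfl⟩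
  · exact .inr (.inl ⟨L, b, R, hb, rfl, rfl⟩)
  · exact absurd hu.allowed (by simpa using not_allAllowed_descent hv ha 0 1 L R)
  · exact .inr (.inr ⟨L, a, b, R, ha, hb, rfl, rfl⟩)

lemma stat_peak {h d : ℕ} {L R : List ℕ} (hv : 0 < v) (hV : ∀ x ∈ V, v < x)
    (hu : IsWord (insert v V) h d ((L ++ [0]) ++ v :: 0 :: R)) :
    stat ((L ++ [0]) ++ v :: 0 :: R) =
      stat (L ++ 0 :: R) + (2 * ((0 :: R).count 0 - 1) + ((L ++ [0]).count 0 - 1)) := by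
  have hl := hu.lt_of_insert hv hV
  have hc := hu.ascStr_add_one hv hV
  have h1 := patCount_insert_both (Q := R) (P := L) (v := v) (fun x hx => hl.1 x (by simp [hx]))
  have h2 := patCount_insert_both (Q := L.reverse) (P := R.reverse) (v := v)
    (fun x hx => hl.2 x (by simp at hx; simp [hx]))
  simp only [List.reverse_append, List.reverse_cons, List.append_assoc, List.cons_append,
    List.nil_append, stat, List.reverse_nil] at hc ⊢
  omega

lemma stat_ascent {h d : ℕ} {L R : List ℕ} (hv : 0 < v) (hV : ∀ x ∈ V, v < x)
    (hu : IsWord (insert v V) h d ((L ++ [0]) ++ v :: R)) :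
    stat ((L ++ [0]) ++ v :: R) =
      stat (L ++ 0 :: R) + (2 * (R.count 0 - 1) + ((L ++ [0]).count 0 - 1)) := by
  have hl := hu.lt_of_insert hv hV
  have hc := hu.ascStr_add_one hv hV
  have h1 := patCount_insert_left (Q := R) (P := L) (v := v) (fun x hx => hl.1 x (by simp [hx]))
  have h2 := patCount_insert_right (Q := L.reverse) (P := R.reverse) (v := v)
    (fun x hx => hl.2 x (by simpa using hx))
  simp only [List.reverse_append, List.reverse_cons, List.append_assoc, List.cons_append,
    List.nil_append, stat, List.reverse_nil] at hc ⊢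
  omega

lemma stat_valley {h d : ℕ} {L R : List ℕ} (hv : 0 < v) (hV : ∀ x ∈ V, v < x)
    (hu : IsWord (insert v V) h d (L ++ v :: R)) :
    stat (L ++ v :: R) = stat (L ++ 0 :: R) + (2 * (R.count 0 - 1) + (L.count 0 - 1)) := by
  have hl := hu.lt_of_insert hv hV
  have hc := hu.ascStr_add_one hv hV
  have h1 := patCount_insert_mid (Q := R) (P := L) (v := v) hl.1
  have h2 := patCount_insert_mid (Q := L.reverse) (P := R.reverse) (v := v)
    (fun x hx => hl.2 x (by simpa using hx))
  simp only [List.reverse_append, List.reverse_cons, List.append_assoc, List.cons_append,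
    List.nil_append, stat] at hc ⊢
  omega

end Recursion

section Sums

open Polynomial

variable {V : Finset ℕ} {v : ℕ}

/-- The polynomial `∑ q ^ i (q ^ 2) ^ (h - i)` over `0 ≤ i ≤ h`. -/
noncomputable def twoVarNat (h : ℕ) : ℤ[X] := ∑ i ∈ range (h + 1), X ^ (2 * (h - i) + i)

lemma dvd_twoVarNat {h : ℕ} (hh : Odd h) : (X + X ^ 2 : ℤ[X]) ∣ twoVarNat h := by
  obtain ⟨m, rfl⟩ := hh
  induction m with
  | zero => simp [twoVarNat, sum_range_succ, add_comm]
  | succ m ih =>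
    have : twoVarNat (2 * (m + 1) + 1) =
        X ^ 4 * twoVarNat (2 * m + 1) + (X + X ^ 2) * X ^ (2 * m + 2) := by
      rw [twoVarNat, show 2 * (m + 1) + 1 + 1 = 2 * m + 1 + 1 + 1 + 1 by ring, sum_range_succ,
        sum_range_succ, twoVarNat, mul_sum, add_assoc]
      congr 1
      · refine sum_congr rfl fun i hi => ?_
        rw [mem_range] at hi
        rw [← pow_add]
        congr 1
        omega
      · rw [show 2 * (2 * (m + 1) + 1 - (2 * m + 1 + 1)) + (2 * m + 1 + 1) = 2 * m + 4 by omega,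
          show 2 * (2 * (m + 1) + 1 - (2 * m + 1 + 1 + 1)) + (2 * m + 1 + 1 + 1) = 2 * m + 3 by
            omega]
        ring
    rw [this]
    exact dvd_add (ih.mul_left _) (dvd_mul_right _ _)

lemma takeWhile_ne_append {L R : List ℕ} (h : v ∉ L) :
    (L ++ v :: R).takeWhile (· ≠ v) = L := by
  rw [List.takeWhile_append_of_pos (by rintro a ha; simpa using ne_of_mem_of_not_mem ha h)]
  simp

lemma dropWhile_ne_append {L R : List ℕ} (h : v ∉ L) :
    (L ++ v :: R).dropWhile (· ≠ v) = v :: R := by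
  rw [List.dropWhile_append_of_pos (by rintro a ha; simpa using ne_of_mem_of_not_mem ha h)]
  simp

/-- If the words of `S` arise from the words of `T` by inserting the letter `v` at one of
`h + 1` places, then the generating function of `T` is multiplied by `twoVarNat h`. -/
lemma sum_insert_eq {S T : Finset (List ℕ)} {h : ℕ} (f : List ℕ → List ℕ → List ℕ)
    (hsplit : ∀ u ∈ S, ∃ L R, u = L ++ v :: R ∧ v ∉ L)
    (hmem : ∀ L R, v ∉ L → L ++ v :: R ∈ S → f L R ∈ T ∧ 1 ≤ L.count 0 ∧ L.count 0 ≤ h + 1 ∧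
      stat (L ++ v :: R) = stat (f L R) + (2 * (h + 1 - L.count 0) + (L.count 0 - 1)))
    (hinj : ∀ L R L' R', L ++ v :: R ∈ S → L' ++ v :: R' ∈ S → v ∉ L → v ∉ L' →
      L.count 0 = L'.count 0 → f L R = f L' R' → L = L' ∧ R = R')
    (hsurj : ∀ i ≤ h, ∀ u ∈ T, ∃ L R, v ∉ L ∧ L ++ v :: R ∈ S ∧ L.count 0 = i + 1 ∧ f L R = u) :
    ∑ u ∈ S, (X : ℤ[X]) ^ stat u = twoVarNat h * ∑ u ∈ T, X ^ stat u := by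
  rw [twoVarNat, sum_mul_sum, ← sum_product']
  refine sum_bij (fun u _ => ((u.takeWhile (· ≠ v)).count 0 - 1,
    f (u.takeWhile (· ≠ v)) (u.dropWhile (· ≠ v)).tail)) ?_ ?_ ?_ ?_
  · intro u hu
    obtain ⟨L, R, rfl, hL⟩ := hsplit u hu
    rw [takeWhile_ne_append hL, dropWhile_ne_append hL, List.tail_cons]
    obtain ⟨h1, h2, h3, -⟩ := hmem L R hL hu
    simp only [mem_product, mem_range]
    exact ⟨by omega, h1⟩
  · intro u hu w hw
    obtain ⟨L, R, rfl, hL⟩ := hsplit u hu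
    obtain ⟨L', R', rfl, hL'⟩ := hsplit w hw
    rw [takeWhile_ne_append hL, dropWhile_ne_append hL, List.tail_cons,
      takeWhile_ne_append hL', dropWhile_ne_append hL', List.tail_cons, Prod.mk.injEq]
    rintro ⟨h1, h2⟩
    have h3 := hmem L R hL hu
    have h4 := hmem L' R' hL' hw
    obtain ⟨rfl, rfl⟩ := hinj L R L' R' hu hw hL hL' (by omega) h2
    rfl
  · rintro ⟨i, u⟩ hiu
    simp only [mem_product, mem_range] at hiu
    obtain ⟨L, R, hL, hS, hc, rfl⟩ := hsurj i (by omega) u hiu.2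
    refine ⟨L ++ v :: R, hS, ?_⟩
    rw [takeWhile_ne_append hL, dropWhile_ne_append hL, List.tail_cons, hc]
    simp
  · intro u hu
    obtain ⟨L, R, rfl, hL⟩ := hsplit u hu
    rw [takeWhile_ne_append hL, dropWhile_ne_append hL, List.tail_cons]
    obtain ⟨-, h2, h3, h4⟩ := hmem L R hL hu
    rw [h4, ← pow_add, add_comm]
    congr 3
    omega

lemma IsWord.exists_split {h d : ℕ} {u : List ℕ} (hv : 0 < v)
    (hu : IsWord (insert v V) h d u) : ∃ L R, u = L ++ v :: R ∧ v ∉ L := by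
  refine List.eq_append_cons_of_mem (List.count_pos_iff.1 ?_)
  rw [hu.count_letter v hv.ne']
  simp

lemma IsWord.count_bounds {h d : ℕ} {L R : List ℕ} (hv : 0 < v) (hV : ∀ x ∈ V, v < x)
    (hu : IsWord (insert v V) h d (L ++ v :: R)) :
    1 ≤ L.count 0 ∧ 1 ≤ R.count 0 ∧ L.count 0 + R.count 0 = h + 1 := by
  have h1 := hu.ascStr_add_one hv hV
  have h2 := hu.count_zero
  simp [hv.ne'] at h2
  omega

/-- The letter following `v` in `u` is zero. -/
def ZeroAfter (v : ℕ) (u : List ℕ) : Prop := (u.dropWhile (· ≠ v)).tail.head? = some 0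

/-- The letter preceding `v` in `u` is zero. -/
def ZeroBefore (v : ℕ) (u : List ℕ) : Prop := (u.takeWhile (· ≠ v)).getLast? = some 0

lemma zeroAfter_iff {L R : List ℕ} (h : v ∉ L) :
    ZeroAfter v (L ++ v :: R) ↔ R.head? = some 0 := by
  rw [ZeroAfter, dropWhile_ne_append h, List.tail_cons]

lemma zeroBefore_iff {L R : List ℕ} (h : v ∉ L) :
    ZeroBefore v (L ++ v :: R) ↔ L.getLast? = some 0 := by
  rw [ZeroBefore, takeWhile_ne_append h]

lemma notMem_of_lt {L : List ℕ} (hv : 0 < v) (h : ∀ x ∈ L, x = 0 ∨ v < x) : v ∉ L :=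
  fun hm => by have := h v hm; omega

variable {h d : ℕ}

lemma zero_notMem_insert (hv : 0 < v) (hV : ∀ x ∈ V, v < x) : 0 ∉ V ∧ 0 ∉ insert v V := by
  have : 0 ∉ V := fun h => by have := hV 0 h; omega
  simp [this, hv.ne]

open Classical in
lemma sum_peak (hv : 0 < v) (hV : ∀ x ∈ V, v < x) :
    ∑ u ∈ (words (insert v V) (h + 1) (d + 1)).filter (ZeroAfter v), (X : ℤ[X]) ^ stat u =
      twoVarNat h * ∑ u ∈ words V h d, X ^ stat u := by
  obtain ⟨h0, h0'⟩ := zero_notMem_insert hv hV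
  have key : ∀ L R, v ∉ L →
      L ++ v :: R ∈ (words (insert v V) (h + 1) (d + 1)).filter (ZeroAfter v) →
      IsWord (insert v V) (h + 1) (d + 1) (L ++ v :: R) ∧
        ∃ L' R', L = L' ++ [0] ∧ R = 0 :: R' := by
    intro L R hL hu
    rw [mem_filter, mem_words h0', zeroAfter_iff hL] at hu
    refine ⟨hu.1, ?_⟩
    rcases hu.1.cases_insert hv hV with h | ⟨L', b, R', hb, rfl, rfl⟩ |
      ⟨L', a, b, R', ha, hb, rfl, rfl⟩
    · exact h
    all_goals simp at hu; omega
  refine sum_insert_eq (v := v) (fun L R => L ++ R.tail) (fun u hu => ?_) (fun L R hL hu => ?_)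
    (fun L R L₂ R₂ hu hu₂ hL hL₂ hc hf => ?_) (fun i hi u hu => ?_)
  · exact ((mem_words h0').1 (mem_filter.1 hu).1).exists_split hv
  · obtain ⟨hw, L, R, rfl, rfl⟩ := key L R hL hu
    have hb := hw.count_bounds hv hV
    refine ⟨?_, hb.1, by omega, ?_⟩
    · rw [mem_words h0]
      simpa using (isWord_peak hv hV).1 (by simpa using hw)
    · rw [stat_peak hv hV hw, List.tail_cons, List.append_assoc, List.singleton_append]
      congr 2
      omega
  · obtain ⟨-, L, R, rfl, rfl⟩ := key L R hL hu
    obtain ⟨-, L₂, R₂, rfl, rfl⟩ := key L₂ R₂ hL₂ hu₂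
    obtain ⟨rfl, rfl⟩ := append_zero_cons_inj (by simpa using hf) (by simpa using hc)
    exact ⟨rfl, rfl⟩
  · rw [mem_words h0] at hu
    obtain ⟨P, Q, rfl, hP⟩ := exists_split_zero (i := i) (u := u) (by rw [hu.count_zero]; omega)
    have hw := (isWord_peak hv hV).2 hu
    have hn : v ∉ P ++ [0] := notMem_of_lt hv fun x hx =>
      hu.lt_of_mem hV x (by simp at hx ⊢; tauto)
    refine ⟨P ++ [0], 0 :: Q, hn, ?_, by simp [hP], by simp⟩
    rw [mem_filter, mem_words h0', zeroAfter_iff hn]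
    simpa using hw

open Classical in
lemma sum_ascent (hv : 0 < v) (hV : ∀ x ∈ V, v < x) :
    ∑ u ∈ ((words (insert v V) (h + 1) d).filter (¬ ZeroAfter v ·)).filter (ZeroBefore v),
      (X : ℤ[X]) ^ stat u = twoVarNat h * ∑ u ∈ words V (h + 1) d, X ^ stat u := by
  obtain ⟨h0, h0'⟩ := zero_notMem_insert hv hV
  have key : ∀ L R, v ∉ L → L ++ v :: R ∈
        ((words (insert v V) (h + 1) d).filter (¬ ZeroAfter v ·)).filter (ZeroBefore v) →
      IsWord (insert v V) (h + 1) d (L ++ v :: R) ∧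
        ∃ L' b R', v < b ∧ L = L' ++ [0] ∧ R = b :: R' := by
    intro L R hL hu
    rw [mem_filter, mem_filter, mem_words h0', zeroAfter_iff hL, zeroBefore_iff hL] at hu
    refine ⟨hu.1.1, ?_⟩
    rcases hu.1.1.cases_insert hv hV with ⟨L', R', rfl, rfl⟩ | h |
      ⟨L', a, b, R', ha, hb, rfl, rfl⟩
    · simp at hu
    · exact h
    · simp at hu; omega
  refine sum_insert_eq (v := v) (fun L R => L ++ R) (fun u hu => ?_) (fun L R hL hu => ?_)
    (fun L R L₂ R₂ hu hu₂ hL hL₂ hc hf => ?_) (fun i hi u hu => ?_)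
  · exact ((mem_words h0').1 (mem_filter.1 (mem_filter.1 hu).1).1).exists_split hv
  · obtain ⟨hw, L, b, R, hvb, rfl, rfl⟩ := key L R hL hu
    have hb := hw.count_bounds hv hV
    refine ⟨?_, hb.1, by omega, ?_⟩
    · rw [mem_words h0]
      simpa using (isWord_ascent hv hV hvb).1 (by simpa using hw)
    · rw [stat_ascent hv hV hw, List.append_assoc, List.singleton_append]
      congr 2
      omega
  · obtain ⟨-, L, b, R, hb, rfl, rfl⟩ := key L R hL hu
    obtain ⟨-, L₂, b₂, R₂, hb₂, rfl, rfl⟩ := key L₂ R₂ hL₂ hu₂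
    obtain ⟨rfl, hR⟩ := append_zero_cons_inj (by simpa using hf) (by simpa using hc)
    exact ⟨rfl, hR⟩
  · rw [mem_words h0] at hu
    have hz := hu.count_zero
    obtain ⟨P, Q, rfl, hP⟩ := exists_split_zero (i := i) (u := u) (by omega)
    rcases Q with _ | ⟨b, Q⟩
    · simp at hz; omega
    have hb : v < b := by
      have h1 := (List.isChain_cons_cons.1 hu.allowed.isChain.tail.right_of_append).1
      have h2 := hu.lt_of_mem hV b (by simp)
      omega
    have hw := (isWord_ascent hv hV hb).2 hu
    have hn : v ∉ P ++ [0] := notMem_of_lt hv fun x hx =>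
      hu.lt_of_mem hV x (by simp at hx ⊢; tauto)
    refine ⟨P ++ [0], b :: Q, hn, ?_, by simp [hP], by simp⟩
    rw [mem_filter, mem_filter, mem_words h0', zeroAfter_iff hn, zeroBefore_iff hn]
    have : b ≠ 0 := by omega
    simpa [this] using hw

open Classical in
lemma sum_valley (hv : 0 < v) (hV : ∀ x ∈ V, v < x) :
    ∑ u ∈ ((words (insert v V) (h + 1) d).filter (¬ ZeroAfter v ·)).filter (¬ ZeroBefore v ·),
      (X : ℤ[X]) ^ stat u = twoVarNat h * ∑ u ∈ words V (h + 2) d, X ^ stat u := by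
  obtain ⟨h0, h0'⟩ := zero_notMem_insert hv hV
  have key : ∀ L R, v ∉ L → L ++ v :: R ∈
        ((words (insert v V) (h + 1) d).filter (¬ ZeroAfter v ·)).filter (¬ ZeroBefore v ·) →
      IsWord (insert v V) (h + 1) d (L ++ v :: R) ∧
        ∃ L' a b R', v < a ∧ v < b ∧ L = L' ++ [a] ∧ R = b :: R' := by
    intro L R hL hu
    rw [mem_filter, mem_filter, mem_words h0', zeroAfter_iff hL, zeroBefore_iff hL] at hu
    refine ⟨hu.1.1, ?_⟩
    rcases hu.1.1.cases_insert hv hV with ⟨L', R', rfl, rfl⟩ | ⟨L', b, R', hb, rfl, rfl⟩ | h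
    · simp at hu
    · simp at hu
    · exact h
  refine sum_insert_eq (v := v) (fun L R => L ++ 0 :: R) (fun u hu => ?_) (fun L R hL hu => ?_)
    (fun L R L₂ R₂ hu hu₂ hL hL₂ hc hf => append_zero_cons_inj hf hc) (fun i hi u hu => ?_)
  · exact ((mem_words h0').1 (mem_filter.1 (mem_filter.1 hu).1).1).exists_split hv
  · obtain ⟨hw, L, a, b, R, hva, hvb, rfl, rfl⟩ := key L R hL hu
    have hb := hw.count_bounds hv hV
    refine ⟨?_, hb.1, by omega, ?_⟩
    · rw [mem_words h0]
      simpa using (isWord_valley hv hV hva hvb).1 (by simpa using hw)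
    · rw [stat_valley hv hV hw]
      congr 2
      omega
  · rw [mem_words h0] at hu
    have hz := hu.count_zero
    obtain ⟨P, Q, rfl, hP⟩ := exists_split_zero (i := i + 1) (u := u) (by omega)
    rcases Q with _ | ⟨b, Q⟩
    · simp at hz; omega
    rcases List.eq_nil_or_concat P with rfl | ⟨P, a, rfl⟩
    · simp at hP
    rw [List.concat_eq_append] at *
    have hc := hu.allowed.isChain.tail
    simp only [List.append_assoc, List.singleton_append, List.tail_cons] at hc
    have hc := List.isChain_cons_cons.1 hc.right_of_append
    have hc' := (List.isChain_cons_cons.1 hc.2).1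
    have ha : v < a := by
      have h2 := hu.lt_of_mem hV a (by simp)
      omega
    have hb : v < b := by
      have h2 := hu.lt_of_mem hV b (by simp)
      omega
    have hw := (isWord_valley hv hV ha hb).2 (by simpa using hu)
    have hn : v ∉ P ++ [a] := notMem_of_lt hv fun x hx =>
      hu.lt_of_mem hV x (by simp at hx ⊢; tauto)
    refine ⟨P ++ [a], b :: Q, hn, ?_, hP, rfl⟩
    rw [mem_filter, mem_filter, mem_words h0', zeroAfter_iff hn, zeroBefore_iff hn]
    have : b ≠ 0 := by omega
    have : a ≠ 0 := by omega
    simp [*]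

lemma words_insert_zero (hv : 0 < v) (hV : ∀ x ∈ V, v < x) : words (insert v V) 0 d = ∅ := by
  refine eq_empty_of_forall_notMem fun u hu => ?_
  rw [mem_words (zero_notMem_insert hv hV).2] at hu
  obtain ⟨L, R, rfl, -⟩ := hu.exists_split hv
  have := hu.count_bounds hv hV
  omega

lemma words_empty (hd : d ≠ 0) : words ∅ h d = ∅ := by
  refine eq_empty_of_forall_notMem fun u hu => ?_
  rw [mem_words (by simp)] at hu
  have h1 : ∀ x ∈ u, x = 0 := by
    intro x hx
    by_contra hx0
    have := hu.count_letter x hx0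
    exact List.count_eq_zero.1 (by simpa using this) hx
  have h2 : ∀ q, q = 0 → ∀ w : List ℕ, (∀ x ∈ w, x = 0) → descCount q w = 0 := by
    intro q hq w hw
    induction w generalizing q with
    | nil => rfl
    | cons b t ih =>
      rw [descCount, ih b (hw b (by simp)) fun x hx => hw x (by simp [hx])]
      simp [hq]
  exact hd (by rw [← hu.desc, h2 0 rfl u h1])

lemma pow_dvd_sum_words (V : Finset ℕ) (hV : 0 ∉ V) (h d : ℕ) :
    (X + X ^ 2 : ℤ[X]) ^ (d - (h + 1) / 2) ∣ ∑ u ∈ words V h d, X ^ stat u := by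
  classical
  induction V using Finset.induction_on_min generalizing h d with
  | empty =>
    rcases eq_or_ne d 0 with rfl | hd
    · simp
    · simp [words_empty hd]
  | insert v V hlt ih =>
    have hv : 0 < v := Nat.pos_of_ne_zero fun h => hV (by simp [h])
    have h0 : 0 ∉ V := fun h => hV (by simp [h])
    rcases h with _ | h
    · simp [words_insert_zero hv hlt]
    rcases d with _ | d
    · simp
    rw [← sum_filter_add_sum_filter_not _ (ZeroAfter v),
      ← sum_filter_add_sum_filter_not (filter (¬ ZeroAfter v ·) _) (ZeroBefore v),
      sum_peak hv hlt, sum_ascent hv hlt, sum_valley hv hlt, ← mul_add, ← mul_add]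
    have h1 := ih h0 h d
    have h2 := ih h0 (h + 1) (d + 1)
    have h3 := ih h0 (h + 2) (d + 1)
    rcases Nat.even_or_odd h with hh | hh
    · refine Dvd.dvd.mul_left (dvd_add ?_ (dvd_add ?_ ?_)) _
      · exact (pow_dvd_pow _ (by grind)).trans h1
      · exact h2
      · exact (pow_dvd_pow _ (by grind)).trans h3
    · refine (pow_dvd_pow _ (show _ ≤ 1 + (d - (h + 1) / 2) by grind)).trans ?_
      rw [pow_add, pow_one]
      refine mul_dvd_mul (dvd_twoVarNat hh) (dvd_add h1 (dvd_add ?_ ?_))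
      · exact (pow_dvd_pow _ (by grind)).trans h2
      · exact (pow_dvd_pow _ (by grind)).trans h3

end Sums

lemma map_range_succ (f : ℕ → ℕ) (m : ℕ) :
    (List.range (m + 1)).map f = f 0 :: (List.range m).map fun i => f (i + 1) := by
  rw [List.range_succ_eq_map, List.map_cons, List.map_map]
  rfl

lemma ascStr_map_range (x : ℕ) (f : ℕ → ℕ) (m : ℕ) :
    ascStr x (f 0) ((List.range m).map fun i => f (i + 1)) =
      ∑ j ∈ range m, if f j < x ∧ x < f (j + 1) then 1 else 0 := by
  induction m generalizing f with
  | zero => rfl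
  | succ m ih =>
    rw [map_range_succ, ascStr, ih fun i => f (i + 1), sum_range_succ', add_comm]

lemma patCount_map_range (f : ℕ → ℕ) (m : ℕ) :
    patCount ((List.range (m + 1)).map f) = ∑ i ∈ range (m + 1), ∑ j ∈ range m,
      if i < j ∧ f j < f i ∧ f i < f (j + 1) then 1 else 0 := by
  induction m generalizing f with
  | zero => simp [patCount, ascStr]
  | succ m ih =>
    rw [map_range_succ, patCount, ih, ascStr_map_range, sum_range_succ' _ (m + 1), add_comm]
    congr 1
    · refine sum_congr rfl fun i _ => ?_
      rw [sum_range_succ']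
      simp
    · refine sum_congr rfl fun j _ => ?_
      rcases j with _ | j <;> simp

lemma ascStr_reverse_map_range (x : ℕ) (f : ℕ → ℕ) (m : ℕ) :
    ascStr x (f m) ((List.range m).map f).reverse =
      ∑ i ∈ range m, if f (i + 1) < x ∧ x < f i then 1 else 0 := by
  induction m with
  | zero => rfl
  | succ m ih =>
    rw [List.range_succ, List.map_append, List.reverse_append, List.map_singleton,
      List.reverse_singleton, List.singleton_append, ascStr, ih, sum_range_succ, add_comm]

lemma patCount_reverse_map_range (f : ℕ → ℕ) (m : ℕ) :
    patCount ((List.range m).map f).reverse = ∑ j ∈ range m, ∑ i ∈ range m,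
      if i < j ∧ f (i + 1) < f j ∧ f j < f i then 1 else 0 := by
  induction m with
  | zero => rfl
  | succ m ih =>
    rw [List.range_succ, List.map_append, List.reverse_append, List.map_singleton,
      List.reverse_singleton, List.singleton_append, patCount, ih, ascStr_reverse_map_range,
      sum_range_succ, add_comm]
    congr 1
    · refine sum_congr rfl fun j hj => ?_
      rw [mem_range] at hj
      rw [sum_range_succ, if_neg (by omega), add_zero]
    · rw [sum_range_succ, if_neg (by omega), add_zero]
      refine sum_congr rfl fun i hi => ?_
      rw [mem_range] at hi
      simp [hi]

lemma patCount_append_zero (L : List ℕ) : patCount (L ++ [0]) = patCount L := by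
  have := patCount_append_congr (A := [0]) (B := []) (c := 0) L
    (fun x _ q => by simp [ascStr]) (by simp [patCount, ascStr])
  simpa using this

lemma descCount_map_range (f : ℕ → ℕ) (m : ℕ) :
    descCount (f 0) ((List.range m).map fun i => f (i + 1)) =
      ∑ j ∈ range m, if f (j + 1) < f j then 1 else 0 := by
  induction m generalizing f with
  | zero => rfl
  | succ m ih =>
    rw [map_range_succ, descCount, ih fun i => f (i + 1), sum_range_succ', add_comm]

lemma allAllowed_map_range (f : ℕ → ℕ) (m : ℕ) :
    AllAllowed (f 0) (f 1) ((List.range m).map fun i => f (i + 2)) ↔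
      ∀ i < m, Allowed (f i) (f (i + 1)) (f (i + 2)) := by
  induction m generalizing f with
  | zero => simp [AllAllowed]
  | succ m ih =>
    rw [map_range_succ, AllAllowed, ih fun i => f (i + 1)]
    constructor
    · rintro ⟨h0, h⟩ (_ | i) hi
      · exact h0
      · exact h i (by omega)
    · exact fun h => ⟨h 0 (by omega), fun i hi => h (i + 1) (by omega)⟩

section Perm

variable {n : ℕ} (σ : Equiv.Perm (Fin n))

/-- The word `0 σ(1) … σ(n) 0`. -/
def permWord : List ℕ := 0 :: (List.range (n + 1)).map (wrd σ)

lemma wrd_pos_iff (i : ℕ) : 0 < wrd σ i ↔ i < n := by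
  unfold wrd
  split_ifs with h <;> simp [h]

lemma resN_eq : resN σ = patCount (permWord σ) := by
  rw [permWord, patCount_zero_cons, patCount_map_range, ← sum_product', ← card_filter, resN]
  congr 1
  ext ⟨i, j⟩
  have := wrd_pos_iff σ (j + 1)
  simp only [mem_filter, mem_product, mem_range]
  omega

lemma lesN_eq : lesN σ = patCount (permWord σ).reverse := by
  rw [permWord, List.reverse_cons, patCount_append_zero, patCount_reverse_map_range,
    ← sum_product', ← card_filter, lesN]
  refine card_nbij' (fun p => (p.2, p.1 - 1)) (fun p => (p.2 + 1, p.1)) ?_ ?_ ?_ ?_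
  · rintro ⟨i, j⟩ h
    simp only [coe_filter, Set.mem_ofPred_eq, mem_product, mem_Ico, mem_range] at h ⊢
    rw [Nat.sub_add_cancel h.1.1.1]
    omega
  · rintro ⟨j, i⟩ h
    have := wrd_pos_iff σ j
    simp only [coe_filter, Set.mem_ofPred_eq, mem_product, mem_Ico, mem_range] at h ⊢
    rw [Nat.add_sub_cancel]
    have : i + 1 ≠ j := by
      rintro rfl
      omega
    omega
  · rintro ⟨i, j⟩ h
    simp only [coe_filter, Set.mem_ofPred_eq, mem_product, mem_Ico] at h
    simp only [Prod.mk.injEq, and_true]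
    omega
  · rintro ⟨j, i⟩ h
    simp

lemma descCount_permWord (hn : 1 ≤ n) : descCount 0 (permWord σ) = desN σ + 1 := by
  obtain ⟨n, rfl⟩ := Nat.exists_eq_add_of_le' hn
  rw [permWord, map_range_succ, descCount, descCount, descCount_map_range, sum_range_succ, desN,
    card_filter]
  have h1 := wrd_pos_iff σ n
  have h2 := wrd_pos_iff σ (n + 1)
  rw [if_pos (show wrd σ (n + 1) < wrd σ n by omega)]
  simp

lemma allAllowed_permWord (hn : 1 ≤ n) : AllAllowed 0 1 (permWord σ) ↔ ddN σ = 0 := by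
  have h := allAllowed_map_range (fun i => if i = 0 then 0 else wrd σ (i - 1)) n
  simp only [Nat.add_eq_zero_iff, OfNat.ofNat_ne_zero, one_ne_zero, and_false, if_false, if_true,
    Nat.sub_self, Nat.add_sub_cancel, show ∀ i, i + 2 - 1 = i + 1 from fun _ => rfl] at h
  rw [permWord, map_range_succ, AllAllowed, AllAllowed, h, ddN, card_eq_zero,
    filter_eq_empty_iff]
  have h0 := wrd_pos_iff σ 0
  constructor
  · rintro ⟨-, -, h⟩ i hi
    rw [mem_Ico] at hi
    have := (h i hi.2).2
    rwa [if_neg (by omega)] at this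
  · intro h
    refine ⟨by simp [Allowed], ⟨by omega, by omega⟩, fun i hi => ?_⟩
    have h1 := wrd_pos_iff σ i
    refine ⟨by omega, ?_⟩
    split_ifs with hi0
    · omega
    · exact h (mem_Ico.2 ⟨by omega, hi⟩)

lemma map_wrd_range : (List.range n).map (wrd σ) = List.ofFn fun i => (σ i : ℕ) + 1 := by
  refine List.ext_getElem (by simp) fun i h1 h2 => ?_
  have : i < n := by simpa using h1
  simp [wrd, this]

lemma permWord_eq : permWord σ = 0 :: ((List.ofFn fun i => (σ i : ℕ) + 1) ++ [0]) := by
  rw [permWord, List.range_succ, List.map_append, map_wrd_range, List.map_singleton]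
  simp [wrd]

lemma isWord_permWord (hn : 1 ≤ n) (hσ : ddN σ = 0) :
    IsWord (Icc 1 n) 1 (desN σ + 1) (permWord σ) := by
  have hnd : (List.ofFn fun i => (σ i : ℕ) + 1).Nodup := by
    refine List.nodup_ofFn.2 fun i j hij => ?_
    simpa [Fin.val_inj] using hij
  have hmem : ∀ x, x ∈ (List.ofFn fun i => (σ i : ℕ) + 1) ↔ x ∈ Icc 1 n := by
    intro x
    rw [List.mem_ofFn, mem_Icc]
    constructor
    · rintro ⟨i, rfl⟩
      have := (σ i).isLt
      omega
    · rintro ⟨h1, h2⟩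
      refine ⟨σ.symm ⟨x - 1, by omega⟩, ?_⟩
      simp only [Equiv.apply_symm_apply]
      omega
  refine ⟨?_, fun x hx => ?_, rfl, ?_, (allAllowed_permWord σ hn).2 hσ, descCount_permWord σ hn⟩
  · rw [permWord_eq, List.count_cons_self, List.count_append, hnd.count]
    simp [hmem]
  · rw [permWord_eq, List.count_cons_of_ne hx.symm, List.count_append, hnd.count]
    simp [hmem, hx.symm]
  · rw [permWord_eq, ← List.cons_append, List.getLast?_concat]

lemma permWord_injective : Function.Injective (permWord (n := n)) := by
  intro σ τ h
  rw [permWord_eq, permWord_eq, List.cons_inj_right, List.append_left_inj, List.ofFn_inj] at h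
  ext i
  simpa using congrFun h i

lemma IsWord.exists_perm {d : ℕ} {u : List ℕ} (hu : IsWord (Icc 1 n) 1 d u) :
    ∃ σ : Equiv.Perm (Fin n), permWord σ = u := by
  have h0 := hu.count_zero
  have hl := hu.count_letter
  have hhead := hu.head
  have hlast := hu.last
  rcases u with _ | ⟨a, t⟩
  · simp at h0
  obtain rfl : a = 0 := by simpa using hhead
  rcases List.eq_nil_or_concat t with rfl | ⟨w, b, rfl⟩
  · simp at h0
  rw [List.concat_eq_append] at *
  obtain rfl : b = 0 := by simpa [List.getLast?_cons] using hlast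
  have hc : ∀ x, w.count x = if x ∈ Icc 1 n then 1 else 0 := by
    intro x
    rcases eq_or_ne x 0 with rfl | hx
    · simpa using h0
    · rw [← hl x hx]
      simp [hx.symm]
  have hnd : w.Nodup := List.nodup_iff_count_le_one.2 fun x => by
    rw [hc]
    split_ifs <;> simp
  have hmem : ∀ x, x ∈ w ↔ x ∈ Icc 1 n := by
    intro x
    rw [← List.count_pos_iff, hc]
    split_ifs with h <;> simp [h]
  have hlen : w.length = n := by
    rw [← List.toFinset_card_of_nodup hnd, show w.toFinset = Icc 1 n by ext x; simp [hmem],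
      Nat.card_Icc, Nat.add_sub_cancel]
  have hw : ∀ i : Fin n, 1 ≤ w[i] ∧ w[i] ≤ n := fun i =>
    mem_Icc.1 ((hmem _).1 (List.getElem_mem _))
  let f : Fin n → Fin n := fun i => ⟨w[i] - 1, by have := hw i; omega⟩
  have hf : Function.Injective f := by
    intro i j hij
    have hij' : w[i] - 1 = w[j] - 1 := congrArg Fin.val hij
    have hi := hw i
    have hj := hw j
    exact Fin.ext ((hnd.getElem_inj_iff).1 (show w[i] = w[j] by omega))
  refine ⟨Equiv.ofBijective f (Finite.injective_iff_bijective.1 hf), ?_⟩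
  rw [permWord_eq]
  congr 2
  refine List.ext_getElem (by simp [hlen]) fun i h1 h2 => ?_
  have := hw ⟨i, by omega⟩
  simp only [Fin.getElem_fin] at this
  simp [f]
  omega

lemma sum_DDset_eq (hn : 1 ≤ n) (k : ℕ) :
    ∑ σ ∈ DDset n k, (Polynomial.X : Polynomial ℤ) ^ (2 * resN σ + lesN σ) =
      ∑ u ∈ words (Icc 1 n) 1 (k + 1), Polynomial.X ^ stat u := by
  refine sum_bij (fun σ _ => permWord σ) (fun σ hσ => ?_)
    (fun σ _ τ _ h => permWord_injective h) (fun u hu => ?_) (fun σ _ => ?_)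
  · simp only [DDset, mem_filter, mem_univ, true_and] at hσ
    rw [mem_words (by simp), ← hσ.1]
    exact isWord_permWord σ hn hσ.2
  · rw [mem_words (by simp)] at hu
    obtain ⟨σ, rfl⟩ := hu.exists_perm
    refine ⟨σ, ?_, rfl⟩
    have h1 := hu.desc
    rw [descCount_permWord σ hn] at h1
    simp only [DDset, mem_filter, mem_univ, true_and]
    exact ⟨by omega, (allAllowed_permWord σ hn).1 hu.allowed⟩
  · rw [stat, resN_eq, lesN_eq]

end Perm

theorem stmt2 (n k : ℕ) (hn : 1 ≤ n) (hk : k ≤ (n - 1) / 2) :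
    (Polynomial.X : Polynomial ℤ) ^ k * (1 + Polynomial.X) ^ k ∣
      ∑ σ ∈ DDset n k, (Polynomial.X : Polynomial ℤ) ^ (2 * resN σ + lesN σ) := by
  rw [sum_DDset_eq hn, ← mul_pow]
  have h := pow_dvd_sum_words (Icc 1 n) (by simp) 1 (k + 1)
  rwa [show (Polynomial.X + Polynomial.X ^ 2 : Polynomial ℤ) =
    Polynomial.X * (1 + Polynomial.X) by ring] at h
end

section
/- For every n ≥ 1, Σ_{σ∈D_n} q^{inv σ} t^{exc σ} = Σ_{0 ≤ k ≤ n/2} (Σ_{σ∈DE_{n,k}} q^{inv σ}) t^k (1+t)^{n-2k}, where D_n is the set of derangements of [n] and DE_{n,k} is the set of derangements with exactly k excedances and no cyclic double ascent. -/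
open Finset

section DropFunctions

variable {α : Type*} [LinearOrder α]

/-- Number of inversions of `φ` among the points of `X`. -/
def invOn (X : Finset α) (φ : α → α) : ℕ :=
  ((X ×ˢ X).filter fun p => p.1 < p.2 ∧ φ p.2 < φ p.1).card

/-- The `q`-integer `1 + q + ⋯ + q ^ (m - 1)`. -/
def qInt (q : ℤ) (m : ℕ) : ℤ :=
  ∑ i ∈ Finset.range m, q ^ i

lemma sum_pow_card_filter_lt (q : ℤ) (Z : Finset α) :
    ∑ y ∈ Z, q ^ (Z.filter (· < y)).card = qInt q Z.card := by
  induction Z using Finset.induction_on_max with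
  | empty => simp [qInt]
  | insert a s ha ih =>
    have hna : a ∉ s := fun h => lt_irrefl _ (ha a h)
    rw [sum_insert hna, card_insert_of_notMem hna, qInt, sum_range_succ, ← qInt, ← ih, add_comm]
    congr 1
    · refine sum_congr rfl fun y hy => ?_
      rw [filter_insert, if_neg (ha y hy).not_gt]
    · rw [filter_insert, if_neg (lt_irrefl _), filter_true_of_mem ha]

lemma image_eq_of_drop {X Y : Finset α} {φ : α → α} (hc : X.card = Y.card)
    (h : ∀ x ∈ X, φ x ∈ Y) (hi : Set.InjOn φ X) : X.image φ = Y := by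
  apply eq_of_subset_of_card_le
  · intro y hy
    obtain ⟨x, hx, rfl⟩ := mem_image.1 hy
    exact h x hx
  · rw [card_image_of_injOn hi, hc]

lemma invOn_insert_min {a : α} {X Y : Finset α} {φ : α → α} (ha : ∀ x ∈ X, a < x)
    (hc : (insert a X).card = Y.card) (h : ∀ x ∈ insert a X, φ x ∈ Y)
    (hi : Set.InjOn φ ↑(insert a X)) :
    invOn (insert a X) φ = (Y.filter (· < φ a)).card + invOn X φ := by
  have hna : a ∉ X := fun h => lt_irrefl _ (ha a h)
  have himg := image_eq_of_drop hc h hi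
  have h1 : ((insert a X ×ˢ insert a X).filter fun p : α × α => p.1 < p.2 ∧ φ p.2 < φ p.1)
      = ((X.filter fun x => φ x < φ a).image fun x => (a, x)) ∪
        ((X ×ˢ X).filter fun p => p.1 < p.2 ∧ φ p.2 < φ p.1) := by
    ext ⟨x, y⟩
    simp only [mem_filter, mem_product, mem_insert, mem_union, mem_image, Prod.mk.injEq]
    constructor
    · rintro ⟨⟨rfl | hx, rfl | hy⟩, h1, h2⟩
      · exact absurd h1 (lt_irrefl _)
      · exact Or.inl ⟨y, ⟨hy, h2⟩, rfl, rfl⟩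
      · exact absurd h1 (ha x hx).not_gt
      · exact Or.inr ⟨⟨hx, hy⟩, h1, h2⟩
    · rintro (⟨z, ⟨hz, h2⟩, rfl, rfl⟩ | ⟨⟨hx, hy⟩, h1, h2⟩)
      · exact ⟨⟨Or.inl rfl, Or.inr hz⟩, ha _ hz, h2⟩
      · exact ⟨⟨Or.inr hx, Or.inr hy⟩, h1, h2⟩
  have h2 : Y.filter (· < φ a) = (X.filter fun x => φ x < φ a).image φ := by
    rw [← himg]
    ext y
    simp only [mem_filter, mem_image, mem_insert]
    constructor
    · rintro ⟨⟨x, rfl | hx, rfl⟩, h1⟩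
      · exact absurd h1 (lt_irrefl _)
      · exact ⟨x, ⟨hx, h1⟩, rfl⟩
    · rintro ⟨x, ⟨hx, h1⟩, rfl⟩
      exact ⟨⟨x, Or.inr hx, rfl⟩, h1⟩
  rw [invOn, h1, card_union_of_disjoint, card_image_of_injective, h2, card_image_of_injOn, invOn]
  · intro x hx y hy hxy
    simp only [coe_filter, Set.mem_ofPred_eq] at hx hy
    exact hi (by simp [hx.1]) (by simp [hy.1]) hxy
  · intro x y hxy
    exact (Prod.mk.inj hxy).2
  · rw [disjoint_left]
    rintro ⟨x, y⟩ h1 h2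
    simp only [mem_image, mem_filter, mem_product, Prod.mk.injEq] at h1 h2
    obtain ⟨z, -, rfl, -⟩ := h1
    exact hna h2.1.1

lemma invOn_congr {X : Finset α} {φ ψ : α → α} (h : ∀ x ∈ X, φ x = ψ x) :
    invOn X φ = invOn X ψ := by
  unfold invOn
  congr 1
  refine filter_congr fun p hp => ?_
  rw [mem_product] at hp
  rw [h _ hp.1, h _ hp.2]

lemma invOn_orderDual (X : Finset α) (φ : α → α) :
    @invOn αᵒᵈ _ X φ = @invOn α _ X φ := by
  refine card_bij' (fun p _ => (p.2, p.1)) (fun p _ => (p.2, p.1)) ?_ ?_ ?_ ?_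
  · intro p hp
    have hp' := mem_filter.1 hp
    have hm := mem_product.1 hp'.1
    exact mem_filter.2 ⟨mem_product.2 ⟨hm.2, hm.1⟩, hp'.2⟩
  · intro p hp
    have hp' := mem_filter.1 hp
    have hm := mem_product.1 hp'.1
    exact mem_filter.2 ⟨mem_product.2 ⟨hm.2, hm.1⟩, hp'.2⟩
  · intro p _; rfl
  · intro p _; rfl

variable [Fintype α]

/-- Injective maps from `X` to `Y` that move every point of `X` strictly down, extended by the
identity outside `X`. -/
def dropFns (X Y : Finset α) : Finset (α → α) :=
  Finset.univ.filter fun φ =>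
    (∀ x, x ∉ X → φ x = x) ∧ (∀ x ∈ X, φ x ∈ Y ∧ φ x < x) ∧ Set.InjOn φ X

lemma mem_dropFns {X Y : Finset α} {φ : α → α} :
    φ ∈ dropFns X Y ↔
      (∀ x, x ∉ X → φ x = x) ∧ (∀ x ∈ X, φ x ∈ Y ∧ φ x < x) ∧ Set.InjOn φ X := by
  simp [dropFns]

/-- Inversion generating function of `dropFns X Y`. -/
def dropSum (q : ℤ) (X Y : Finset α) : ℤ :=
  ∑ φ ∈ dropFns X Y, q ^ invOn X φ

lemma dropSum_insert_min (q : ℤ) {a : α} {X Y : Finset α} (ha : ∀ x ∈ X, a < x)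
    (hc : (insert a X).card = Y.card) :
    dropSum q (insert a X) Y =
      ∑ y ∈ Y.filter (· < a), q ^ (Y.filter (· < y)).card * dropSum q X (Y.erase y) := by
  have hna : a ∉ X := fun h => lt_irrefl _ (ha a h)
  have hne : ∀ x ∈ X, x ≠ a := fun x hx => (ha x hx).ne'
  simp only [dropSum, mul_sum]
  rw [sum_sigma']
  refine sum_bij' (fun φ _ => ⟨φ a, Function.update φ a a⟩)
    (fun p _ => Function.update p.2 a p.1) ?_ ?_ ?_ ?_ ?_
  · intro φ hφ
    simp only [mem_dropFns, mem_filter, mem_sigma] at hφ ⊢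
    obtain ⟨h1, h2, h3⟩ := hφ
    refine ⟨h2 a (mem_insert_self _ _), ?_, ?_, ?_⟩
    · intro x hx
      by_cases hxa : x = a
      · simp [hxa]
      · simp [hxa, h1 x (by simp [hxa, hx])]
    · intro x hx
      rw [Function.update_of_ne (hne x hx), mem_erase]
      refine ⟨⟨fun h => hne x hx (h3 (by simp [hx]) (by simp) h), ?_⟩, ?_⟩
      · exact (h2 x (mem_insert_of_mem hx)).1
      · exact (h2 x (mem_insert_of_mem hx)).2
    · intro x hx y hy hxy
      rw [Function.update_of_ne (hne x hx), Function.update_of_ne (hne y hy)] at hxy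
      exact h3 (mem_insert_of_mem hx) (mem_insert_of_mem hy) hxy
  · rintro ⟨y, φ⟩ hp
    simp only [mem_dropFns, mem_filter, mem_sigma] at hp ⊢
    obtain ⟨⟨hy, hya⟩, h1, h2, h3⟩ := hp
    refine ⟨?_, ?_, ?_⟩
    · intro x hx
      rw [mem_insert, not_or] at hx
      rw [Function.update_of_ne hx.1, h1 x hx.2]
    · intro x hx
      rcases mem_insert.1 hx with rfl | hx
      · simp [hy, hya]
      · rw [Function.update_of_ne (hne x hx)]
        exact ⟨mem_of_mem_erase (h2 x hx).1, (h2 x hx).2⟩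
    · intro x hx z hz hxz
      rw [mem_coe, mem_insert] at hx hz
      rcases hx with rfl | hx <;> rcases hz with rfl | hz
      · rfl
      · rw [Function.update_self, Function.update_of_ne (hne z hz)] at hxz
        exact absurd hxz.symm (ne_of_mem_erase (h2 z hz).1)
      · rw [Function.update_self, Function.update_of_ne (hne x hx)] at hxz
        exact absurd hxz (ne_of_mem_erase (h2 x hx).1)
      · rw [Function.update_of_ne (hne x hx), Function.update_of_ne (hne z hz)] at hxz
        exact h3 hx hz hxz
  · intro φ _
    simp
  · rintro ⟨y, φ⟩ hp
    simp only [mem_dropFns, mem_filter, mem_sigma] at hp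
    have : φ a = a := hp.2.1 a hna
    simp only [Function.update_self, Function.update_idem, Sigma.mk.injEq, heq_eq_eq, true_and]
    exact Function.update_eq_self_iff.2 this.symm
  · intro φ hφ
    rw [mem_dropFns] at hφ
    rw [invOn_insert_min ha hc (fun x hx => (hφ.2.1 x hx).1) hφ.2.2, pow_add]
    congr 2
    exact invOn_congr fun x hx => (Function.update_of_ne (hne x hx) _ _).symm

lemma dropSum_eq_prod (q : ℤ) (X Y : Finset α) (hc : X.card = Y.card) :
    dropSum q X Y =
      ∏ x ∈ X, qInt q ((Y.filter (· < x)).card - (X.filter (· < x)).card) := by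
  induction X using Finset.induction_on_min generalizing Y with
  | empty =>
    have : dropFns (∅ : Finset α) Y = {fun x => x} := by
      ext φ
      simp [mem_dropFns, funext_iff]
    simp [dropSum, this, invOn]
  | insert a s ha ih =>
    have hna : a ∉ s := fun h => lt_irrefl _ (ha a h)
    rw [dropSum_insert_min q ha hc, prod_insert hna]
    have h0 : ((insert a s).filter (· < a)) = ∅ := by
      rw [filter_eq_empty_iff]
      intro x hx
      rcases mem_insert.1 hx with rfl | hx
      · exact lt_irrefl _
      · exact (ha x hx).not_gt
    rw [h0, card_empty, Nat.sub_zero, ← sum_pow_card_filter_lt, sum_mul]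
    refine sum_congr rfl fun y hy => ?_
    rw [mem_filter] at hy
    congr 1
    · rw [filter_filter]
      congr 2
      refine filter_congr fun z _ => ⟨fun h => ⟨h.trans hy.2, h⟩, fun h => h.2⟩
    · rw [ih]
      · refine prod_congr rfl fun x hx => ?_
        rw [filter_insert, if_pos (ha x hx), card_insert_of_notMem (by simp [hna]),
          filter_erase, card_erase_of_mem (by simp [hy.1, hy.2.trans (ha x hx)]),
          Nat.sub_sub, add_comm]
      · rw [card_insert_of_notMem hna] at hc
        rw [card_erase_of_mem hy.1]
        omega

lemma dropSum_insert (q : ℤ) {X Y : Finset α} (hc : X.card = Y.card) {a : α}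
    (hX : a ∉ X) (hY : a ∉ Y) :
    dropSum q (insert a X) (insert a Y) =
      qInt q ((Y.filter (· < a)).card - (X.filter (· < a)).card) * dropSum q X Y := by
  rw [dropSum_eq_prod, dropSum_eq_prod _ _ _ hc, prod_insert hX]
  · congr 1
    · simp [filter_insert]
    · refine prod_congr rfl fun x hx => ?_
      simp only [filter_insert]
      split_ifs with h
      · rw [card_insert_of_notMem (fun h => hY (mem_filter.1 h).1),
          card_insert_of_notMem (fun h => hX (mem_filter.1 h).1),
          Nat.add_sub_add_right]
      · rfl
  · rw [card_insert_of_notMem hX, card_insert_of_notMem hY, hc]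

/-- The mirror image of `dropSum`: the maps move every point of `X` strictly up. -/
def riseSum (q : ℤ) (X Y : Finset α) : ℤ :=
  dropSum (α := αᵒᵈ) q X Y

lemma riseSum_insert (q : ℤ) {X Y : Finset α} (hc : X.card = Y.card) {a : α}
    (hX : a ∉ X) (hY : a ∉ Y) :
    riseSum q (insert a X) (insert a Y) =
      qInt q ((Y.filter (a < ·)).card - (X.filter (a < ·)).card) * riseSum q X Y :=
  dropSum_insert (α := αᵒᵈ) q hc hX hY

/-- Injective maps from `X` to `Y` that move every point of `X` strictly up, extended by the
identity outside `X`. -/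
def riseFns (X Y : Finset α) : Finset (α → α) :=
  Finset.univ.filter fun φ =>
    (∀ x, x ∉ X → φ x = x) ∧ (∀ x ∈ X, φ x ∈ Y ∧ x < φ x) ∧ Set.InjOn φ X

lemma mem_riseFns {X Y : Finset α} {φ : α → α} :
    φ ∈ riseFns X Y ↔
      (∀ x, x ∉ X → φ x = x) ∧ (∀ x ∈ X, φ x ∈ Y ∧ x < φ x) ∧ Set.InjOn φ X := by
  simp [riseFns]

lemma mem_dropFns_orderDual (X Y : Finset α) (φ : α → α) :
    φ ∈ @dropFns αᵒᵈ _ _ X Y ↔ φ ∈ riseFns X Y :=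
  (@mem_dropFns αᵒᵈ _ _ X Y φ).trans (@mem_riseFns α _ _ X Y φ).symm

lemma riseSum_eq (q : ℤ) (X Y : Finset α) :
    riseSum q X Y = ∑ φ ∈ riseFns X Y, q ^ invOn X φ :=
  sum_bij (fun φ _ => φ) (fun φ h => (mem_dropFns_orderDual X Y φ).1 h)
    (fun _ _ _ _ h => h) (fun φ h => ⟨φ, (mem_dropFns_orderDual X Y φ).2 h, rfl⟩)
    (fun φ _ => congrArg (q ^ ·) (invOn_orderDual X φ))

end DropFunctions

lemma sum_powerset_pow_card {α : Type*} (s : Finset α) (t : ℤ) :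
    ∑ A ∈ s.powerset, t ^ A.card = (1 + t) ^ s.card := by
  rw [add_comm, ← sum_pow_mul_eq_add_pow]
  simp

section Fibers

variable {α : Type*} [LinearOrder α]

lemma card_filter_lt_add_card_filter_gt {E : Finset α} {x : α} (hx : x ∉ E) :
    (E.filter (· < x)).card + (E.filter (x < ·)).card = E.card := by
  rw [← card_filter_add_card_filter_not (s := E) (· < x)]
  congr 2
  refine filter_congr fun y hy => ?_
  have : y ≠ x := fun h => hx (h ▸ hy)
  rw [not_lt]
  exact ⟨le_of_lt, fun h => lt_of_le_of_ne h this.symm⟩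

variable [Fintype α]

/-- Number of pairs `i < j` with `i ∈ E` and `j ∉ E`. -/
def gapN (E : Finset α) : ℕ :=
  ((E ×ˢ Eᶜ).filter fun p => p.1 < p.2).card

lemma gapN_eq_sum (E : Finset α) : gapN E = ∑ i ∈ E, (Eᶜ.filter (i < ·)).card := by
  simp only [gapN, card_filter, sum_product]

lemma gapN_insert {E : Finset α} {x : α} (hx : x ∉ E) :
    gapN (insert x E) + (E.filter (· < x)).card = gapN E + ((Eᶜ).filter (x < ·)).card := by
  have h1 : Eᶜ = insert x (insert x E)ᶜ := by
    ext y
    by_cases h : y = x <;> simp [h, hx]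
  have h2 : ∀ i ∈ E, (Eᶜ.filter (i < ·)).card =
      ((insert x E)ᶜ.filter (i < ·)).card + if i < x then 1 else 0 := by
    intro i _
    rw [h1, filter_insert]
    split_ifs with h
    · rw [card_insert_of_notMem (by simp)]
    · simp
  rw [gapN_eq_sum, gapN_eq_sum, sum_insert hx, sum_congr rfl h2, sum_add_distrib,
    ← card_filter]
  have h3 : Eᶜ.filter (x < ·) = (insert x E)ᶜ.filter (x < ·) := by
    conv_lhs => rw [h1, filter_insert, if_neg (lt_irrefl _)]
  rw [h3]
  ring

lemma card_compl_filter_add (E : Finset α) (p : α → Prop) [DecidablePred p] :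
    (Eᶜ.filter p).card + (E.filter p).card = (univ.filter p).card := by
  rw [add_comm, ← card_union_of_disjoint (disjoint_filter_filter disjoint_compl_right),
    ← filter_union, union_compl]

/-- Positions of the excedances of `σ`. -/
def excPos (σ : Equiv.Perm α) : Finset α :=
  Finset.univ.filter fun i => i < σ i

/-- Values of the excedances of `σ`. -/
def excVal (σ : Equiv.Perm α) : Finset α :=
  Finset.univ.filter fun i => σ.symm i < i

lemma mem_excPos {σ : Equiv.Perm α} {i : α} : i ∈ excPos σ ↔ i < σ i := by simp [excPos]

lemma mem_excVal {σ : Equiv.Perm α} {i : α} : i ∈ excVal σ ↔ σ.symm i < i := by simp [excVal]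

lemma apply_mem_excVal {σ : Equiv.Perm α} {i : α} : σ i ∈ excVal σ ↔ i ∈ excPos σ := by
  simp [mem_excVal, mem_excPos]

lemma card_excVal (σ : Equiv.Perm α) : (excVal σ).card = (excPos σ).card := by
  symm
  refine card_bij (fun i _ => σ i) (fun i hi => apply_mem_excVal.2 hi)
    (fun _ _ _ _ h => σ.injective h) fun j hj => ⟨σ.symm j, ?_, by simp⟩
  rw [← apply_mem_excVal]
  simpa using hj

lemma invOn_univ_eq {σ : Equiv.Perm α} (hσ : ∀ i, σ i ≠ i) :
    invOn univ σ = gapN (excPos σ) - gapN (excVal σ) +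
      (invOn (excPos σ) σ + invOn (excPos σ)ᶜ σ) := by
  have hdrop : ∀ i, i ∉ excPos σ → σ i < i := fun i hi =>
    lt_of_le_of_ne (not_lt.1 fun h => hi (mem_excPos.2 h)) (hσ i)
  have h1 : gapN (excVal σ) =
      ((excPos σ ×ˢ (excPos σ)ᶜ).filter fun p => p.1 < p.2 ∧ σ p.1 < σ p.2).card := by
    symm
    refine card_bij (fun p _ => (σ p.1, σ p.2)) ?_ ?_ ?_
    · rintro ⟨i, j⟩ h
      simp only [mem_filter, mem_product, mem_compl, apply_mem_excVal] at h ⊢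
      exact ⟨h.1, h.2.2⟩
    · rintro ⟨i, j⟩ _ ⟨i', j'⟩ _ h
      simpa using h
    · rintro ⟨u, v⟩ h
      obtain ⟨i, rfl⟩ := σ.surjective u
      obtain ⟨j, rfl⟩ := σ.surjective v
      simp only [mem_filter, mem_product, mem_compl, apply_mem_excVal] at h
      refine ⟨(i, j), ?_, rfl⟩
      simp only [mem_filter, mem_product, mem_compl]
      exact ⟨h.1, ((mem_excPos.1 h.1.1).trans h.2).trans (hdrop j h.1.2), h.2⟩
  have h2 : gapN (excPos σ) =
      ((excPos σ ×ˢ (excPos σ)ᶜ).filter fun p => p.1 < p.2 ∧ σ p.2 < σ p.1).card +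
      ((excPos σ ×ˢ (excPos σ)ᶜ).filter fun p => p.1 < p.2 ∧ σ p.1 < σ p.2).card := by
    rw [gapN, ← card_union_of_disjoint]
    · congr 1
      ext ⟨i, j⟩
      simp only [mem_filter, mem_union]
      constructor
      · rintro ⟨h, hij⟩
        rcases lt_or_gt_of_ne (fun h => hij.ne (σ.injective h) : σ i ≠ σ j) with h' | h'
        · exact Or.inr ⟨h, hij, h'⟩
        · exact Or.inl ⟨h, hij, h'⟩
      · rintro (h | h) <;> exact ⟨h.1, h.2.1⟩
    · rw [disjoint_filter]
      exact fun p _ h h' => lt_asymm h.2 h'.2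
  have h3 : invOn univ σ = invOn (excPos σ) σ + invOn (excPos σ)ᶜ σ +
      ((excPos σ ×ˢ (excPos σ)ᶜ).filter fun p => p.1 < p.2 ∧ σ p.2 < σ p.1).card := by
    rw [invOn, invOn, invOn, ← card_union_of_disjoint, ← card_union_of_disjoint]
    · congr 1
      ext ⟨i, j⟩
      simp only [mem_filter, mem_union, mem_product, mem_univ, true_and, mem_compl]
      by_cases hi : i ∈ excPos σ <;> by_cases hj : j ∈ excPos σ <;> simp only [hi, hj] <;> simp
      intro hij
      exact (((hdrop i hi).trans hij).trans (mem_excPos.1 hj)).le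
    · rw [disjoint_left]
      rintro ⟨i, j⟩ h h'
      simp only [mem_filter, mem_union, mem_product, mem_compl] at h h'
      tauto
    · rw [disjoint_left]
      rintro ⟨i, j⟩ h h'
      simp only [mem_filter, mem_product, mem_compl] at h h'
      tauto
  omega

/-- Derangements with excedance positions `E` and excedance values `F`. -/
def derFiber (E F : Finset α) : Finset (Equiv.Perm α) :=
  Finset.univ.filter fun σ => (∀ i, σ i ≠ i) ∧ excPos σ = E ∧ excVal σ = F

lemma mem_derFiber {E F : Finset α} {σ : Equiv.Perm α} :
    σ ∈ derFiber E F ↔ (∀ i, σ i ≠ i) ∧ excPos σ = E ∧ excVal σ = F := by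
  simp [derFiber]

/-- Inversion generating function of `derFiber E F`. -/
def fiberSum (q : ℤ) (E F : Finset α) : ℤ :=
  ∑ σ ∈ derFiber E F, q ^ invOn univ σ

lemma fiberSum_eq_zero (q : ℤ) {E F : Finset α} (h : E.card ≠ F.card) : fiberSum q E F = 0 := by
  refine sum_eq_zero fun σ hσ => absurd ?_ h
  obtain ⟨-, rfl, rfl⟩ := mem_derFiber.1 hσ
  exact (card_excVal σ).symm

lemma mem_derFiber_of_eqOn {E F : Finset α} {φ ψ : α → α} {σ : Equiv.Perm α}
    (hφ : ∀ x ∈ E, φ x ∈ F ∧ x < φ x) (hψ : ∀ x ∈ Eᶜ, ψ x ∈ Fᶜ ∧ ψ x < x)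
    (hσ : ∀ x, σ x = E.piecewise φ ψ x) : σ ∈ derFiber E F := by
  have h1 : ∀ x ∈ E, σ x ∈ F ∧ x < σ x := fun x hx => by
    rw [hσ, piecewise_eq_of_mem _ _ _ hx]; exact hφ x hx
  have h2 : ∀ x, x ∉ E → σ x ∉ F ∧ σ x < x := fun x hx => by
    rw [hσ, piecewise_eq_of_notMem _ _ _ hx]; simpa using hψ x (mem_compl.2 hx)
  have hE : excPos σ = E := by
    ext x
    rw [mem_excPos]
    by_cases hx : x ∈ E
    · simp [hx, (h1 x hx).2]
    · simp [hx, (h2 x hx).2.le]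
  refine mem_derFiber.2 ⟨fun x => ?_, hE, ?_⟩
  · by_cases hx : x ∈ E
    · exact (h1 x hx).2.ne'
    · exact (h2 x hx).2.ne
  · ext y
    obtain ⟨x, rfl⟩ := σ.surjective y
    rw [apply_mem_excVal, hE]
    by_cases hx : x ∈ E
    · simp [hx, (h1 x hx).1]
    · simp [hx, (h2 x hx).1]

lemma fiberSum_eq (q : ℤ) (E F : Finset α) :
    fiberSum q E F = q ^ (gapN E - gapN F) * (riseSum q E F * dropSum q Eᶜ Fᶜ) := by
  rw [riseSum_eq, dropSum, sum_mul_sum, ← sum_product', mul_sum]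
  refine sum_bij (fun σ _ => (E.piecewise σ id, Eᶜ.piecewise σ id)) ?_ ?_ ?_ ?_
  · intro σ hσ
    obtain ⟨hd, rfl, rfl⟩ := mem_derFiber.1 hσ
    rw [mem_product, mem_riseFns, mem_dropFns]
    refine ⟨⟨fun x hx => ?_, fun x hx => ?_, fun x hx y hy h => ?_⟩,
      fun x hx => ?_, fun x hx => ?_, fun x hx y hy h => ?_⟩
    · simp only [piecewise_eq_of_notMem _ _ _ hx, id]
    · simp only [piecewise_eq_of_mem _ _ _ hx]
      exact ⟨apply_mem_excVal.2 hx, mem_excPos.1 hx⟩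
    · rw [mem_coe] at hx hy
      simp only [piecewise_eq_of_mem _ _ _ hx, piecewise_eq_of_mem _ _ _ hy] at h
      exact σ.injective h
    · simp only [piecewise_eq_of_notMem _ _ _ hx, id]
    · simp only [piecewise_eq_of_mem _ _ _ hx]
      rw [mem_compl] at hx ⊢
      rw [apply_mem_excVal]
      exact ⟨hx, lt_of_le_of_ne (not_lt.1 fun h => hx (mem_excPos.2 h)) (hd x)⟩
    · rw [mem_coe] at hx hy
      simp only [piecewise_eq_of_mem _ _ _ hx, piecewise_eq_of_mem _ _ _ hy] at h
      exact σ.injective h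
  · intro σ _ τ _ h
    rw [Prod.mk.injEq] at h
    ext x
    by_cases hx : x ∈ E
    · simpa [hx] using congrFun h.1 x
    · simpa [hx] using congrFun h.2 x
  · rintro ⟨φ, ψ⟩ h
    rw [mem_product, mem_riseFns, mem_dropFns] at h
    dsimp only at h
    obtain ⟨⟨hφ1, hφ2, hφ3⟩, hψ1, hψ2, hψ3⟩ := h
    have hinj : Function.Injective (E.piecewise φ ψ) := by
      intro x y hxy
      by_cases hx : x ∈ E <;> by_cases hy : y ∈ E <;> simp only [hx, hy,
        piecewise_eq_of_mem, piecewise_eq_of_notMem, not_false_eq_true] at hxy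
      · exact hφ3 hx hy hxy
      · exact absurd (hφ2 x hx).1 (hxy ▸ mem_compl.1 (hψ2 y (mem_compl.2 hy)).1)
      · exact absurd (hφ2 y hy).1 (hxy ▸ mem_compl.1 (hψ2 x (mem_compl.2 hx)).1)
      · exact hψ3 (by simpa using hx) (by simpa using hy) hxy
    refine ⟨Equiv.ofBijective _ (Finite.injective_iff_bijective.1 hinj),
      mem_derFiber_of_eqOn hφ2 hψ2 fun x => rfl, ?_⟩
    rw [Prod.mk.injEq]
    constructor
    · ext x
      by_cases hx : x ∈ E
      · simp [hx]
      · simpa [hx] using (hφ1 x hx).symm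
    · ext x
      by_cases hx : x ∈ E
      · simpa [hx] using (hψ1 x (by simpa using hx)).symm
      · simp [hx]
  · intro σ hσ
    obtain ⟨hd, rfl, rfl⟩ := mem_derFiber.1 hσ
    have h1 : invOn (excPos σ) ((excPos σ).piecewise σ id) = invOn (excPos σ) σ :=
      invOn_congr fun x hx => piecewise_eq_of_mem _ _ _ hx
    have h2 : invOn (excPos σ)ᶜ ((excPos σ)ᶜ.piecewise σ id) = invOn (excPos σ)ᶜ σ :=
      invOn_congr fun x hx => piecewise_eq_of_mem _ _ _ hx
    simp only [h1, h2]
    rw [← pow_add, ← pow_add, ← invOn_univ_eq hd]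

lemma fiberSum_insert (q : ℤ) {E F : Finset α} {x : α} (hE : x ∉ E) (hF : x ∉ F) :
    fiberSum q (insert x E) (insert x F) = fiberSum q E F := by
  by_cases hc : E.card = F.card
  · have hE' : Eᶜ = insert x (insert x E)ᶜ := by
      ext y
      by_cases h : y = x <;> simp [h, hE]
    have hF' : Fᶜ = insert x (insert x F)ᶜ := by
      ext y
      by_cases h : y = x <;> simp [h, hF]
    have hc' : (insert x E)ᶜ.card = (insert x F)ᶜ.card := by
      rw [card_compl, card_compl, card_insert_of_notMem hE, card_insert_of_notMem hF, hc]
    rw [fiberSum_eq, fiberSum_eq, riseSum_insert q hc hE hF]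
    conv_rhs => rw [hE', hF', dropSum_insert q hc' (by simp) (by simp)]
    have e1 := gapN_insert hE
    have e2 := gapN_insert hF
    have e3 := card_filter_lt_add_card_filter_gt hE
    have e4 := card_filter_lt_add_card_filter_gt hF
    have e5 := card_compl_filter_add E (x < ·)
    have e6 := card_compl_filter_add F (x < ·)
    have e7 := card_compl_filter_add (insert x E) (· < x)
    have e8 := card_compl_filter_add (insert x F) (· < x)
    rw [filter_insert, if_neg (lt_irrefl _)] at e7 e8
    have h1 : gapN (insert x E) - gapN (insert x F) = gapN E - gapN F := by omega
    have h2 : ((insert x F)ᶜ.filter (· < x)).card - ((insert x E)ᶜ.filter (· < x)).card =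
        (F.filter (x < ·)).card - (E.filter (x < ·)).card := by omega
    rw [h1, h2]
    ring
  · rw [fiberSum_eq_zero q hc, fiberSum_eq_zero]
    rw [card_insert_of_notMem hE, card_insert_of_notMem hF]
    omega

lemma fiberSum_union (q : ℤ) {E F A : Finset α} (hE : Disjoint A E) (hF : Disjoint A F) :
    fiberSum q (E ∪ A) (F ∪ A) = fiberSum q E F := by
  induction A using Finset.induction_on with
  | empty => simp
  | insert x A hx ih =>
    rw [disjoint_insert_left] at hE hF
    rw [union_insert, union_insert, fiberSum_insert, ih hE.2 hF.2]
    · simp [hE.1, hx]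
    · simp [hF.1, hx]

lemma sum_fiberSum (q t : ℤ) :
    ∑ σ ∈ univ.filter (fun σ : Equiv.Perm α => ∀ i, σ i ≠ i),
        q ^ invOn univ σ * t ^ (excPos σ).card =
      ∑ p : Finset α × Finset α, fiberSum q p.1 p.2 * t ^ p.1.card := by
  rw [← sum_fiberwise _ (fun σ => (excPos σ, excVal σ))]
  refine sum_congr rfl fun p _ => ?_
  rw [fiberSum, sum_mul]
  refine sum_congr ?_ fun σ hσ => ?_
  · ext σ
    simp [mem_derFiber, Prod.ext_iff]
  · rw [(mem_derFiber.1 hσ).2.1]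

lemma sum_fiberSum_eq_disjoint (q t : ℤ) :
    ∑ p : Finset α × Finset α, fiberSum q p.1 p.2 * t ^ p.1.card =
      ∑ p ∈ univ.filter (fun p : Finset α × Finset α => Disjoint p.1 p.2),
        fiberSum q p.1 p.2 * t ^ p.1.card * (1 + t) ^ (Fintype.card α - 2 * p.1.card) := by
  have h : ∀ p ∈ univ.filter (fun p : Finset α × Finset α => Disjoint p.1 p.2),
      fiberSum q p.1 p.2 * t ^ p.1.card * (1 + t) ^ (Fintype.card α - 2 * p.1.card) =
        ∑ A ∈ (p.1 ∪ p.2)ᶜ.powerset,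
          fiberSum q (p.1 ∪ A) (p.2 ∪ A) * t ^ (p.1 ∪ A).card := by
    rintro ⟨V, P⟩ hp
    simp only [mem_filter, mem_univ, true_and] at hp
    have hA : ∀ A ∈ (V ∪ P)ᶜ.powerset, Disjoint A V ∧ Disjoint A P := fun A hA => by
      rw [mem_powerset, subset_compl_iff_disjoint_right, disjoint_union_right] at hA
      exact hA
    by_cases hc : V.card = P.card
    · have h1 : (V ∪ P)ᶜ.card = Fintype.card α - 2 * V.card := by
        rw [card_compl, card_union_of_disjoint hp, hc, two_mul]
      rw [← h1, ← sum_powerset_pow_card, mul_sum]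
      refine sum_congr rfl fun A h => ?_
      obtain ⟨hV, hP⟩ := hA A h
      rw [fiberSum_union q hV hP, card_union_of_disjoint hV.symm, pow_add, mul_assoc]
    · rw [fiberSum_eq_zero q hc, zero_mul, zero_mul]
      refine (sum_eq_zero fun A h => ?_).symm
      obtain ⟨hV, hP⟩ := hA A h
      rw [fiberSum_union q hV hP, fiberSum_eq_zero q hc, zero_mul]
  rw [sum_congr rfl h, sum_sigma']
  refine sum_bij' (fun p _ => ⟨(p.1 \ p.2, p.2 \ p.1), p.1 ∩ p.2⟩)
    (fun p _ => (p.1.1 ∪ p.2, p.1.2 ∪ p.2)) ?_ ?_ ?_ ?_ ?_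
  · rintro ⟨E, F⟩ _
    simp only [mem_sigma, mem_filter, mem_univ, true_and, mem_powerset]
    refine ⟨disjoint_sdiff_sdiff, fun x => ?_⟩
    simp only [mem_inter, mem_compl, mem_union, mem_sdiff]
    tauto
  · simp
  · rintro ⟨E, F⟩ _
    ext x <;> simp only [mem_inter, mem_union, mem_sdiff] <;> tauto
  · rintro ⟨⟨V, P⟩, A⟩ hp
    simp only [mem_sigma, mem_filter, mem_univ, true_and, mem_powerset, disjoint_left,
      subset_iff, mem_compl, mem_union] at hp
    have h1 : (V ∪ A) \ (P ∪ A) = V := by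
      ext x
      have := @hp.1 x
      have := @hp.2 x
      simp only [mem_union, mem_sdiff]
      tauto
    have h2 : (P ∪ A) \ (V ∪ A) = P := by
      ext x
      have := @hp.1 x
      have := @hp.2 x
      simp only [mem_union, mem_sdiff]
      tauto
    have h3 : (V ∪ A) ∩ (P ∪ A) = A := by
      ext x
      have := @hp.1 x
      simp only [mem_union, mem_inter]
      tauto
    simp only [h1, h2, h3]
  · rintro ⟨E, F⟩ _
    have h : F \ E ∪ E ∩ F = F := by rw [inter_comm, sdiff_union_inter]
    simp only [sdiff_union_inter, h]

end Fibers

lemma invN_eq_invOn {n : ℕ} (σ : Equiv.Perm (Fin n)) : invN σ = invOn univ σ := by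
  simp [invN, invOn]

lemma cdaN_eq_zero_iff {n : ℕ} (σ : Equiv.Perm (Fin n)) :
    cdaN σ = 0 ↔ Disjoint (excPos σ) (excVal σ) := by
  rw [cdaN, card_eq_zero, filter_eq_empty_iff, disjoint_right]
  constructor
  · intro h j hj hj'
    obtain ⟨i, rfl⟩ := σ.surjective j
    exact h (mem_univ i) ⟨mem_excPos.1 (apply_mem_excVal.1 hj), mem_excPos.1 hj'⟩
  · intro h i _ hi
    exact h (apply_mem_excVal.2 (mem_excPos.2 hi.1)) (mem_excPos.2 hi.2)

lemma two_mul_excN_le {n : ℕ} {σ : Equiv.Perm (Fin n)} (h : cdaN σ = 0) :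
    2 * excN σ ≤ n := by
  have h1 : (excPos σ ∪ excVal σ).card ≤ n := by
    simpa using card_le_univ (excPos σ ∪ excVal σ)
  rw [card_union_of_disjoint ((cdaN_eq_zero_iff σ).1 h), card_excVal] at h1
  change 2 * (excPos σ).card ≤ n
  omega

lemma sum_DEset {n : ℕ} (q t : ℤ) :
    ∑ k ∈ Finset.range (n / 2 + 1),
        (∑ σ ∈ DEset n k, q ^ invN σ) * t ^ k * (1 + t) ^ (n - 2 * k) =
      ∑ σ ∈ (Der n).filter (fun σ => cdaN σ = 0),
        q ^ invN σ * t ^ excN σ * (1 + t) ^ (n - 2 * excN σ) := by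
  rw [← sum_fiberwise_of_maps_to (t := Finset.range (n / 2 + 1)) (g := excN)]
  · refine sum_congr rfl fun k _ => ?_
    rw [sum_mul, sum_mul, filter_filter]
    refine sum_congr ?_ fun σ hσ => ?_
    · ext σ
      simp [DEset, and_comm]
    · rw [(mem_filter.1 hσ).2.2]
  · intro σ hσ
    have := two_mul_excN_le (mem_filter.1 hσ).2
    rw [mem_range]
    omega

lemma sum_Der_filter_cdaN {n : ℕ} (q t : ℤ) :
    ∑ σ ∈ (Der n).filter (fun σ => cdaN σ = 0),
        q ^ invN σ * t ^ excN σ * (1 + t) ^ (n - 2 * excN σ) =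
      ∑ p ∈ univ.filter (fun p : Finset (Fin n) × Finset (Fin n) => Disjoint p.1 p.2),
        fiberSum q p.1 p.2 * t ^ p.1.card * (1 + t) ^ (n - 2 * p.1.card) := by
  rw [← sum_fiberwise_of_maps_to (g := fun σ => (excPos σ, excVal σ))
    (t := univ.filter (fun p : Finset (Fin n) × Finset (Fin n) => Disjoint p.1 p.2))]
  · refine sum_congr rfl fun p hp => ?_
    rw [fiberSum, sum_mul, sum_mul]
    refine Eq.trans (sum_congr ?_ fun σ _ => rfl) (sum_congr rfl fun σ hσ => ?_)
    · ext σ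
      simp only [mem_filter, Der, mem_univ, true_and, mem_derFiber, cdaN_eq_zero_iff,
        Prod.ext_iff] at hp ⊢
      constructor
      · rintro ⟨⟨h1, -⟩, h2⟩
        exact ⟨h1, h2⟩
      · rintro ⟨h1, h2⟩
        exact ⟨⟨h1, by rw [h2.1, h2.2]; exact hp⟩, h2⟩
    · have h : excN σ = p.1.card := by
        rw [← (mem_derFiber.1 hσ).2.1]
        rfl
      rw [h, invN_eq_invOn]
  · intro σ hσ
    rw [mem_filter, cdaN_eq_zero_iff] at hσ
    simpa using hσ.2

theorem stmt3 (n : ℕ) (hn : 1 ≤ n) (q t : ℤ) :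
    (∑ σ ∈ Der n, q ^ invN σ * t ^ excN σ) =
      ∑ k ∈ Finset.range (n / 2 + 1),
        (∑ σ ∈ DEset n k, q ^ invN σ) * t ^ k * (1 + t) ^ (n - 2 * k) := by
  have h1 := sum_fiberSum (α := Fin n) q t
  have h2 := sum_fiberSum_eq_disjoint (α := Fin n) q t
  rw [Fintype.card_fin] at h2
  rw [sum_DEset, sum_Der_filter_cdaN, ← h2, ← h1]
  refine sum_congr ?_ fun σ _ => ?_
  · ext σ
    simp [Der]
  · rw [invN_eq_invOn]
    rfl
end
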